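/- arXiv:2206.00572 — 12 statements merged into one kernel-verified Lean document; each statement's English description precedes it below -/
import Mathlib

section
/- Suppose f = (f_1,…,f_N) is an N-tuple of nonnegative measurable functions on ℝ such that all D+2 components of ρ := ⟨m(ξ) f⟩ are finite and ρ ≠ 0. Then there exists a unique α = (α_0, α̂, α_{D+1}) ∈ ℝ × ℝ^D × ℝ with α_{D+1} < 0 such that the N-tuple 𝓔 with 𝓔_m(ξ) = exp(α · m_m(ξ)) satisfies ⟨m(ξ) 𝓔⟩ = ρ; moreover 𝓔 is the unique minimizer of the discrete entropy H among all N-tuples g of nonnegative measurable functions with ⟨m(ξ) g⟩ = ρ and H[g] finite, i.e. H[g] ≥ H[𝓔] for every such g, with equality if and only if g_m = 𝓔_m almost everywhere for every m. -/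
open scoped RealInnerProductSpace
open MeasureTheory

/-- The discrete equilibrium ansatz `𝓔_m(ξ) = exp (α ⬝ m_m ξ)` where
`α = (α₀, α̂, α_{D+1})` and `α ⬝ m_m ξ = α₀ + ξ ⟪α̂, l m⟫ + (ξ²/2) α_{D+1}`. -/
noncomputable def discEquil {D : ℕ} (lm : EuclideanSpace ℝ (Fin D))
    (α : ℝ × EuclideanSpace ℝ (Fin D) × ℝ) (ξ : ℝ) : ℝ :=
  Real.exp (α.1 + ξ * ⟪α.2.1, lm⟫ + ξ ^ 2 / 2 * α.2.2)

/-- Total mass `⟨f⟩ = Σ_m ∫ f_m`. -/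
noncomputable def mom0 {N : ℕ} (g : Fin N → ℝ → ℝ) : ℝ :=
  ∑ m, ∫ ξ : ℝ, g m ξ

/-- Total momentum `Σ_m (∫ ξ f_m) l_m ∈ ℝᴰ`. -/
noncomputable def mom1 {D N : ℕ} (l : Fin N → EuclideanSpace ℝ (Fin D))
    (g : Fin N → ℝ → ℝ) : EuclideanSpace ℝ (Fin D) :=
  ∑ m, (∫ ξ : ℝ, ξ * g m ξ) • l m

/-- Total energy `Σ_m ∫ (ξ²/2) f_m`. -/
noncomputable def mom2 {N : ℕ} (g : Fin N → ℝ → ℝ) : ℝ :=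
  ∑ m, ∫ ξ : ℝ, ξ ^ 2 / 2 * g m ξ

/-- Discrete entropy `H[g] = Σ_m ∫ (g_m ln g_m − g_m)`. -/
noncomputable def Hent {N : ℕ} (g : Fin N → ℝ → ℝ) : ℝ :=
  ∑ m, ∫ ξ : ℝ, (g m ξ * Real.log (g m ξ) - g m ξ)

open Real in
lemma exp_quadratic_eq_gaussianPDFReal {s : ℝ} (hs : 0 < s) (a v ξ : ℝ) :
    exp (a + ξ * (s * v) + ξ ^ 2 / 2 * (-s ^ 2)) =
      (exp (a + v ^ 2 / 2) * (√(2 * π) / s)) *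
        ProbabilityTheory.gaussianPDFReal (v / s) (Real.toNNReal (1 / s ^ 2)) ξ := by
  rw [ProbabilityTheory.gaussianPDFReal, Real.coe_toNNReal _ (by positivity)]
  have h1 : √(2 * π * (1 / s ^ 2)) = √(2 * π) / s := by
    rw [mul_one_div, Real.sqrt_div (by positivity), Real.sqrt_sq hs.le]
  rw [h1]
  have h2 : √(2 * π) / s ≠ 0 := by positivity
  rw [mul_assoc, mul_inv_cancel_left₀ h2, ← exp_add]
  congr 1
  field_simp
  ring

lemma integrable_gaussianReal_iff {v : NNReal} (hv : v ≠ 0) (μ : ℝ) (g : ℝ → ℝ) :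
    Integrable g (ProbabilityTheory.gaussianReal μ v) ↔
      Integrable fun ξ => ProbabilityTheory.gaussianPDFReal μ v ξ * g ξ := by
  rw [ProbabilityTheory.gaussianReal_of_var_ne_zero μ hv,
    integrable_withDensity_iff_integrable_smul' (ProbabilityTheory.measurable_gaussianPDF μ v)
      (Filter.Eventually.of_forall fun _ => ProbabilityTheory.gaussianPDF_lt_top)]
  simp [ProbabilityTheory.toReal_gaussianPDF]

lemma integral_sq_gaussianReal (μ : ℝ) (v : NNReal) :
    ∫ ξ, ξ ^ 2 ∂ProbabilityTheory.gaussianReal μ v = v + μ ^ 2 := by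
  have h := ProbabilityTheory.variance_eq_sub
    (ProbabilityTheory.memLp_id_gaussianReal (μ := μ) (v := v) 2)
  rw [ProbabilityTheory.variance_id_gaussianReal] at h
  simp only [id, Pi.pow_apply, ProbabilityTheory.integral_id_gaussianReal] at h
  linarith

lemma integrable_pow_mul_exp_quadratic {c : ℝ} (hc : c < 0) (a b : ℝ) (n : ℕ) :
    Integrable fun ξ : ℝ => ξ ^ n * Real.exp (a + ξ * b + ξ ^ 2 / 2 * c) := by
  obtain ⟨s, hs, rfl⟩ : ∃ s : ℝ, 0 < s ∧ c = -s ^ 2 :=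
    ⟨√(-c), Real.sqrt_pos.2 (by linarith), by rw [Real.sq_sqrt (by linarith)]; ring⟩
  obtain ⟨v, rfl⟩ : ∃ v, b = s * v := ⟨b / s, by field_simp⟩
  have hv : Real.toNNReal (1 / s ^ 2) ≠ 0 := by
    rw [Ne, Real.toNNReal_eq_zero, not_le]
    positivity
  have h : Integrable (fun ξ : ℝ => ξ ^ n)
      (ProbabilityTheory.gaussianReal (v / s) (Real.toNNReal (1 / s ^ 2))) := by
    rcases eq_or_ne n 0 with rfl | hn
    · simp
    · have h := (ProbabilityTheory.memLp_id_gaussianReal (μ := v / s)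
        (v := Real.toNNReal (1 / s ^ 2)) n).integrable_norm_pow hn
      refine h.mono' (by fun_prop) (Filter.Eventually.of_forall fun ξ => ?_)
      simp
  rw [integrable_gaussianReal_iff hv] at h
  refine (h.const_mul (Real.exp (a + v ^ 2 / 2) * (√(2 * Real.pi) / s))).congr
    (Filter.Eventually.of_forall fun ξ => ?_)
  simp only [exp_quadratic_eq_gaussianPDFReal hs]
  ring

lemma integral_mul_exp_quadratic {s : ℝ} (hs : 0 < s) (a v : ℝ) (p : ℝ → ℝ) :
    ∫ ξ : ℝ, p ξ * Real.exp (a + ξ * (s * v) + ξ ^ 2 / 2 * (-s ^ 2)) =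
      (Real.exp (a + v ^ 2 / 2) * (√(2 * Real.pi) / s)) *
        ∫ ξ, p ξ ∂ProbabilityTheory.gaussianReal (v / s) (Real.toNNReal (1 / s ^ 2)) := by
  have hv : Real.toNNReal (1 / s ^ 2) ≠ 0 := by
    rw [Ne, Real.toNNReal_eq_zero, not_le]
    positivity
  rw [ProbabilityTheory.integral_gaussianReal_eq_integral_smul hv, ← integral_const_mul]
  congr 1
  ext ξ
  rw [exp_quadratic_eq_gaussianPDFReal hs, smul_eq_mul]
  ring

lemma integral_exp_quadratic_moments {s : ℝ} (hs : 0 < s) (a v : ℝ) :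
    (∫ ξ : ℝ, Real.exp (a + ξ * (s * v) + ξ ^ 2 / 2 * (-s ^ 2)) =
      Real.exp (a + v ^ 2 / 2) * (√(2 * Real.pi) / s)) ∧
    (∫ ξ : ℝ, ξ * Real.exp (a + ξ * (s * v) + ξ ^ 2 / 2 * (-s ^ 2)) =
      Real.exp (a + v ^ 2 / 2) * (√(2 * Real.pi) / s) * (v / s)) ∧
    (∫ ξ : ℝ, ξ ^ 2 / 2 * Real.exp (a + ξ * (s * v) + ξ ^ 2 / 2 * (-s ^ 2)) =
      Real.exp (a + v ^ 2 / 2) * (√(2 * Real.pi) / s) * ((1 + v ^ 2) / s ^ 2 / 2)) := by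
  refine ⟨?_, ?_, ?_⟩
  · simpa using integral_mul_exp_quadratic hs a v fun _ => 1
  · simpa [ProbabilityTheory.integral_id_gaussianReal] using
      integral_mul_exp_quadratic hs a v fun ξ => ξ
  · rw [integral_mul_exp_quadratic hs a v fun ξ => ξ ^ 2 / 2, integral_div,
      integral_sq_gaussianReal, Real.coe_toNNReal _ (by positivity)]
    ring

lemma relativeEntropy_density_nonneg {g e : ℝ} (hg : 0 ≤ g) (he : 0 < e) :
    0 ≤ g * Real.log g - g - g * Real.log e + e ∧
      (g * Real.log g - g - g * Real.log e + e = 0 → g = e) := by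
  rcases hg.eq_or_lt with rfl | hg
  · simp only [zero_mul]
    exact ⟨by linarith, fun h => by linarith⟩
  · have hlog : Real.log (e / g) = Real.log e - Real.log g := Real.log_div he.ne' hg.ne'
    have hmul : g * (e / g) = e := by field_simp
    refine ⟨?_, fun h => ?_⟩
    · have := mul_le_mul_of_nonneg_left (Real.log_le_sub_one_of_pos (div_pos he hg)) hg.le
      rw [hlog, mul_sub g (e / g), hmul] at this
      linarith
    · by_contra hne
      have h1 : e / g ≠ 1 := fun h => hne ((div_eq_one_iff_eq hg.ne').1 h).symm
      have := mul_lt_mul_of_pos_left (Real.log_lt_sub_one_of_pos (div_pos he hg) h1) hg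
      rw [hlog, mul_sub g (e / g), hmul] at this
      linarith

lemma integral_linear_combination₃ {p q r : ℝ → ℝ} (hp : Integrable p) (hq : Integrable q)
    (hr : Integrable r) (a b c : ℝ) :
    ∫ ξ, (a * p ξ + b * q ξ + c * r ξ) = a * (∫ ξ, p ξ) + b * (∫ ξ, q ξ) + c * ∫ ξ, r ξ := by
  have h1 := integral_add ((hp.const_mul a).add (hq.const_mul b)) (hr.const_mul c)
  have h2 := integral_add (hp.const_mul a) (hq.const_mul b)
  simp only [Pi.add_apply, integral_const_mul] at h1 h2
  rw [h1, h2]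

lemma exists_pos_quadratic_lower_bound {K E : ℝ} (h : K ^ 2 < E) :
    ∃ δ > 0, ∀ b s : ℝ, δ * (b ^ 2 + s ^ 2) ≤ b ^ 2 / 2 - s * b * K + s ^ 2 * E / 2 := by
  have hE : 0 < 1 + E := by nlinarith [sq_nonneg K]
  refine ⟨(E - K ^ 2) / (2 * (1 + E)), div_pos (by linarith) (by linarith), fun b s => ?_⟩
  set δ := (E - K ^ 2) / (2 * (1 + E)) with hδ
  have h1 : 2 * δ * (1 + E) = E - K ^ 2 := by rw [hδ]; field_simp
  have h2 : 0 < 1 - 2 * δ := by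
    have : (1 - 2 * δ) * (1 + E) = 1 + K ^ 2 := by linarith
    by_contra hn
    nlinarith [sq_nonneg K]
  have key : 0 ≤ (1 - 2 * δ) *
      (b ^ 2 / 2 - s * b * K + s ^ 2 * E / 2 - δ * (b ^ 2 + s ^ 2)) := by
    have : (1 - 2 * δ) * (b ^ 2 / 2 - s * b * K + s ^ 2 * E / 2 - δ * (b ^ 2 + s ^ 2)) =
        ((1 - 2 * δ) * b - s * K) ^ 2 / 2 + s ^ 2 * (2 * δ) ^ 2 / 2 := by
      linear_combination (-(s ^ 2) / 2) * h1
    rw [this]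
    positivity
  linarith [nonneg_of_mul_nonneg_right key h2]

lemma abs_sub_le_mul_exp_sub {δ : ℝ} (hδ : 0 < δ) (t : ℝ) :
    |t| - 1 / (2 * δ) ≤ δ * Real.exp t ^ 2 - t := by
  have hC : 0 < 1 / (2 * δ) := by positivity
  rcases le_total t 0 with ht | ht
  · rw [abs_of_nonpos ht]
    have : 0 ≤ δ * Real.exp t ^ 2 := by positivity
    linarith
  · rw [abs_of_nonneg ht]
    have hE : 1 / (2 * δ) * (2 * δ) = 1 := by field_simp
    have h3 : δ * Real.exp t ^ 2 - 2 * t + 1 / (2 * δ) ≥ 0 := by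
      have h4 : (1 + t) + t ^ 2 / 2 ≤ Real.exp t := by
        linarith [Real.quadratic_le_exp_of_nonneg ht]
      have h5 : 2 * t ≤ Real.exp t := by nlinarith [sq_nonneg (t - 1)]
      have h6 : 0 ≤ (2 * δ) * (δ * Real.exp t ^ 2 - 2 * t + 1 / (2 * δ)) := by
        linear_combination sq_nonneg (δ * Real.exp t - 1) + sq_nonneg (δ * Real.exp t) +
          2 * mul_le_mul_of_nonneg_left h5 hδ.le - hE
      exact nonneg_of_mul_nonneg_right h6 (by positivity)
    linarith

section DualFunctional

variable {D N : ℕ} (l : Fin N → EuclideanSpace ℝ (Fin D)) (U : EuclideanSpace ℝ (Fin D)) (E : ℝ)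

/-- The partition function `Σ_m exp (⟪w, l_m⟫² / 2)`. -/
noncomputable def partitionFun (w : EuclideanSpace ℝ (Fin D)) : ℝ :=
  ∑ m, Real.exp (⟪w, l m⟫ ^ 2 / 2)

/-- The dual entropy functional, with the mass multiplier eliminated, at the mean velocity `w`
(in thermal units) and at temperature `exp (-2 t)`. -/
noncomputable def dualFunctional (x : EuclideanSpace ℝ (Fin D) × ℝ) : ℝ :=
  Real.log (partitionFun l x.1) - x.2 - Real.exp x.2 * ⟪x.1, U⟫ + Real.exp x.2 ^ 2 * E / 2

lemma partitionFun_pos (hN : 0 < N) (w : EuclideanSpace ℝ (Fin D)) : 0 < partitionFun l w :=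
  Finset.sum_pos (fun _ _ => Real.exp_pos _) ⟨⟨0, hN⟩, Finset.mem_univ _⟩

lemma sq_inner_le_log_partitionFun (w : EuclideanSpace ℝ (Fin D)) (m : Fin N) :
    ⟪w, l m⟫ ^ 2 ≤ 2 * Real.log (partitionFun l w) := by
  have h : Real.exp (⟪w, l m⟫ ^ 2 / 2) ≤ partitionFun l w :=
    Finset.single_le_sum (f := fun m => Real.exp (⟪w, l m⟫ ^ 2 / 2))
      (fun _ _ => (Real.exp_pos _).le) (Finset.mem_univ m)
  have := (Real.le_log_iff_exp_le ((Real.exp_pos _).trans_le h)).2 h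
  linarith

lemma continuous_dualFunctional (hN : 0 < N) : Continuous (dualFunctional l U E) := by
  unfold dualFunctional
  have h : Continuous fun x : EuclideanSpace ℝ (Fin D) × ℝ => Real.log (partitionFun l x.1) := by
    refine Continuous.log ?_ fun x => (partitionFun_pos l hN x.1).ne'
    unfold partitionFun
    fun_prop
  fun_prop

variable {l} in
lemma eq_of_forall_inner_eq (hspan : Submodule.span ℝ (Set.range l) = ⊤)
    {x y : EuclideanSpace ℝ (Fin D)} (h : ∀ m, ⟪x, l m⟫ = ⟪y, l m⟫) : x = y := by
  refine ext_inner_right ℝ fun v => ?_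
  have hv : v ∈ Submodule.span ℝ (Set.range l) := hspan ▸ Submodule.mem_top
  induction hv using Submodule.span_induction with
  | mem v hv => obtain ⟨m, rfl⟩ := hv; exact h m
  | zero => simp
  | add v w _ _ hv hw => rw [inner_add_right, inner_add_right, hv, hw]
  | smul c v _ hv => rw [inner_smul_right, inner_smul_right, hv]

variable {l} in
lemma exists_norm_le_of_abs_inner_le (hspan : Submodule.span ℝ (Set.range l) = ⊤) :
    ∃ κ > 0, ∀ w B, 0 ≤ B → (∀ m, |⟪w, l m⟫| ≤ B) → ‖w‖ ≤ κ * B := by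
  let T : EuclideanSpace ℝ (Fin D) →ₗ[ℝ] (Fin N → ℝ) :=
    LinearMap.pi fun m => (innerSL ℝ (l m)).toLinearMap
  have hT : ∀ w m, T w m = ⟪w, l m⟫ := fun w m => by simp [T, real_inner_comm]
  have hker : LinearMap.ker T = ⊥ := by
    refine LinearMap.ker_eq_bot.2 fun x y hxy => eq_of_forall_inner_eq hspan fun m => ?_
    rw [← hT, ← hT, hxy]
  obtain ⟨κ, hκ, hanti⟩ := T.exists_antilipschitzWith hker
  refine ⟨κ, hκ, fun w B hB hw => ?_⟩
  have h1 : ‖w‖ ≤ κ * ‖T w‖ := by simpa using hanti.le_mul_dist w 0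
  refine h1.trans (mul_le_mul_of_nonneg_left ?_ κ.2)
  exact (pi_norm_le_iff_of_nonneg hB).2 fun m => by rw [hT]; exact hw m

variable {l U E}

lemma tendsto_dualFunctional_cocompact (hN : 0 < N)
    (hspan : Submodule.span ℝ (Set.range l) = ⊤) {K : ℝ} (hKE : K ^ 2 < E)
    (hU : ∀ w B, (∀ m, |⟪w, l m⟫| ≤ B) → ⟪w, U⟫ ≤ B * K) :
    Filter.Tendsto (dualFunctional l U E) (Filter.cocompact _) Filter.atTop := by
  obtain ⟨κ, hκ, hnorm⟩ := exists_norm_le_of_abs_inner_le hspan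
  obtain ⟨δ, hδ, hquad⟩ := exists_pos_quadratic_lower_bound hKE
  set η := min 1 (δ / κ ^ 2) with hη
  have hη0 : 0 < η := lt_min one_pos (by positivity)
  have hbound : ∀ x, η * ‖x‖ + (-(1 / (2 * δ)) - η) ≤ dualFunctional l U E x := by
    rintro ⟨w, t⟩
    set B := √(2 * Real.log (partitionFun l w)) with hB
    have hL : 0 ≤ 2 * Real.log (partitionFun l w) :=
      (sq_nonneg _).trans (sq_inner_le_log_partitionFun l w ⟨0, hN⟩)
    have hB2 : B ^ 2 = 2 * Real.log (partitionFun l w) := Real.sq_sqrt hL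
    have hwB : ∀ m, |⟪w, l m⟫| ≤ B := fun m =>
      Real.abs_le_sqrt (sq_inner_le_log_partitionFun l w m)
    have h1 := hquad B (Real.exp t)
    have h2 := mul_le_mul_of_nonneg_left (hU w B hwB) (Real.exp_pos t).le
    have h3 := abs_sub_le_mul_exp_sub hδ t
    have h4 : ‖w‖ ^ 2 ≤ κ ^ 2 * B ^ 2 := by
      rw [← mul_pow]
      exact pow_le_pow_left₀ (norm_nonneg _) (hnorm w B (Real.sqrt_nonneg _) hwB) 2
    have h5 : η * ‖w‖ ^ 2 ≤ δ * B ^ 2 :=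
      calc η * ‖w‖ ^ 2 ≤ δ / κ ^ 2 * (κ ^ 2 * B ^ 2) := by
            gcongr
            exact min_le_right _ _
        _ = δ * B ^ 2 := by field_simp
    have h6 : ‖w‖ - 1 ≤ ‖w‖ ^ 2 := by nlinarith [sq_nonneg (‖w‖ - 1), norm_nonneg w]
    have h7 : η * (‖w‖ - 1) ≤ η * ‖w‖ ^ 2 := mul_le_mul_of_nonneg_left h6 hη0.le
    have h8 : η * |t| ≤ |t| := mul_le_of_le_one_left (abs_nonneg t) (min_le_left _ _)
    have h9 : ‖(w, t)‖ ≤ ‖w‖ + |t| :=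
      max_le (le_add_of_nonneg_right (abs_nonneg t)) (le_add_of_nonneg_left (norm_nonneg w))
    have h10 := mul_le_mul_of_nonneg_left h9 hη0.le
    simp only [dualFunctional]
    nlinarith
  exact Filter.tendsto_atTop_mono hbound (Filter.tendsto_atTop_add_const_right _ _
    ((tendsto_norm_cocompact_atTop).const_mul_atTop hη0))

lemma inner_gradient_eq_of_forall_dualFunctional_le (hN : 0 < N)
    {w : EuclideanSpace ℝ (Fin D)} {t : ℝ}
    (hmin : ∀ y, dualFunctional l U E (w, t) ≤ dualFunctional l U E y) :
    ∑ m, (Real.exp (⟪w, l m⟫ ^ 2 / 2) * ⟪w, l m⟫) • l m =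
      (partitionFun l w * Real.exp t) • U := by
  refine ext_inner_left ℝ fun d => ?_
  have hlin : ∀ v : EuclideanSpace ℝ (Fin D),
      HasDerivAt (fun r : ℝ => ⟪w + r • d, v⟫) ⟪d, v⟫ 0 := fun v => by
    have h : (fun r : ℝ => ⟪w + r • d, v⟫) = fun r : ℝ => ⟪w, v⟫ + r * ⟪d, v⟫ := by
      ext r
      rw [inner_add_left, real_inner_smul_left]
    rw [h]
    simpa using ((hasDerivAt_id (0 : ℝ)).mul_const ⟪d, v⟫).const_add ⟪w, v⟫
  have hZ : HasDerivAt (fun r : ℝ => partitionFun l (w + r • d))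
      (∑ m, Real.exp (⟪w, l m⟫ ^ 2 / 2) * (⟪w, l m⟫ * ⟪d, l m⟫)) 0 := by
    refine HasDerivAt.fun_sum fun m _ => ?_
    have h := (((hlin (l m)).pow 2).div_const 2).exp
    simp only [zero_smul, add_zero] at h
    exact h.congr_deriv (by simp only [Pi.pow_apply, zero_smul, add_zero]; push_cast; ring)
  have hZ0 := (partitionFun_pos l hN w).ne'
  have hF : HasDerivAt (fun r : ℝ => dualFunctional l U E (w + r • d, t))
      ((∑ m, Real.exp (⟪w, l m⟫ ^ 2 / 2) * (⟪w, l m⟫ * ⟪d, l m⟫)) / partitionFun l w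
        - Real.exp t * ⟪d, U⟫) 0 := by
    have h := hZ.log (by simpa using hZ0)
    simp only [zero_smul, add_zero] at h
    unfold dualFunctional
    exact ((h.sub_const t).sub ((hlin U).const_mul (Real.exp t))).add_const
      (Real.exp t ^ 2 * E / 2)
  have h0 := IsLocalMin.hasDerivAt_eq_zero
    (Filter.Eventually.of_forall fun r => by simpa using hmin _) hF
  rw [sub_eq_zero, div_eq_iff hZ0] at h0
  rw [inner_sum, real_inner_smul_right, mul_assoc, mul_comm, ← h0]
  refine Finset.sum_congr rfl fun m _ => ?_
  rw [real_inner_smul_right]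
  ring

lemma energy_eq_of_forall_dualFunctional_le {w : EuclideanSpace ℝ (Fin D)} {t : ℝ}
    (hmin : ∀ y, dualFunctional l U E (w, t) ≤ dualFunctional l U E y) :
    Real.exp t ^ 2 * E = 1 + Real.exp t * ⟪w, U⟫ := by
  have hF : HasDerivAt (fun r : ℝ => dualFunctional l U E (w, r))
      (0 - 1 - Real.exp t * ⟪w, U⟫ + 2 * Real.exp t * Real.exp t * E / 2) t := by
    have hE := Real.hasDerivAt_exp t
    have h := ((((hasDerivAt_const t (Real.log (partitionFun l w))).sub (hasDerivAt_id t)).sub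
      (hE.mul_const ⟪w, U⟫))).add (((hE.pow 2).mul_const E).div_const 2)
    exact h.congr_deriv (by push_cast; ring)
  have h0 := IsLocalMin.hasDerivAt_eq_zero (Filter.Eventually.of_forall fun r => hmin _) hF
  linarith

lemma exists_dual_critical_point (hN : 0 < N)
    (hspan : Submodule.span ℝ (Set.range l) = ⊤) {K : ℝ} (hKE : K ^ 2 < E)
    (hU : ∀ w B, (∀ m, |⟪w, l m⟫| ≤ B) → ⟪w, U⟫ ≤ B * K) :
    ∃ w, ∃ s > 0, ∑ m, (Real.exp (⟪w, l m⟫ ^ 2 / 2) * ⟪w, l m⟫) • l m =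
      (partitionFun l w * s) • U ∧ s ^ 2 * E = 1 + s * ⟪w, U⟫ := by
  obtain ⟨⟨w, t⟩, hmin⟩ := (continuous_dualFunctional l U E hN).exists_forall_le
    (tendsto_dualFunctional_cocompact hN hspan hKE hU)
  exact ⟨w, Real.exp t, Real.exp_pos t, inner_gradient_eq_of_forall_dualFunctional_le hN hmin,
    energy_eq_of_forall_dualFunctional_le hmin⟩

end DualFunctional

lemma sq_integral_abs_mul_lt {h : ℝ → ℝ} (h0 : ∀ ξ, 0 ≤ h ξ) (hi0 : Integrable h)
    (hi1 : Integrable fun ξ => |ξ| * h ξ) (hi2 : Integrable fun ξ => ξ ^ 2 * h ξ)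
    (hpos : 0 < ∫ ξ, h ξ) :
    (∫ ξ, |ξ| * h ξ) ^ 2 < (∫ ξ, h ξ) * ∫ ξ, ξ ^ 2 * h ξ := by
  set M := ∫ ξ, h ξ with hM
  set A := ∫ ξ, |ξ| * h ξ with hA
  have hexp : (fun ξ => (M * |ξ| - A) ^ 2 * h ξ) = fun ξ =>
      M ^ 2 * (ξ ^ 2 * h ξ) + -(2 * M * A) * (|ξ| * h ξ) + A ^ 2 * h ξ := by
    ext ξ
    rw [← sq_abs ξ]
    ring
  have hint : Integrable fun ξ => (M * |ξ| - A) ^ 2 * h ξ := by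
    rw [hexp]
    exact ((hi2.const_mul _).add (hi1.const_mul _)).add (hi0.const_mul _)
  have hval : ∫ ξ, (M * |ξ| - A) ^ 2 * h ξ = M * (M * (∫ ξ, ξ ^ 2 * h ξ) - A ^ 2) := by
    rw [hexp, integral_linear_combination₃ hi2 hi1 hi0, ← hM, ← hA]
    ring
  have hnonneg : ∀ ξ, 0 ≤ (M * |ξ| - A) ^ 2 * h ξ := fun ξ => mul_nonneg (sq_nonneg _) (h0 ξ)
  have hne : ∫ ξ, (M * |ξ| - A) ^ 2 * h ξ ≠ 0 := by
    intro hzero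
    have hae := (integral_eq_zero_iff_of_nonneg hnonneg hint).1 hzero
    have hfin : ∀ᵐ ξ : ℝ, ξ ∉ ({A / M, -(A / M)} : Set ℝ) :=
      measure_eq_zero_iff_ae_notMem.1 (Set.Finite.measure_zero (Set.toFinite _) _)
    have hh : h =ᵐ[volume] 0 := by
      filter_upwards [hae, hfin] with ξ h1 h2
      rcases mul_eq_zero.1 h1 with h3 | h3
      · refine absurd ?_ h2
        have h4 : |ξ| = A / M := by
          rw [eq_div_iff hpos.ne']
          linarith [pow_eq_zero_iff two_ne_zero |>.1 h3]
        rcases abs_choice ξ with h5 | h5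
        · exact Or.inl (h5.symm.trans h4)
        · exact Or.inr (by rw [Set.mem_singleton_iff, ← h4, h5, neg_neg])
      · exact h3
    rw [hM, integral_congr_ae hh] at hpos
    simp at hpos
  have hlt := (integral_nonneg hnonneg).lt_of_ne' hne
  rw [hval] at hlt
  linarith [pos_of_mul_pos_right hlt hpos.le]

section DiscreteMoments

variable {D N : ℕ} {l : Fin N → EuclideanSpace ℝ (Fin D)} {f g : Fin N → ℝ → ℝ}

lemma mom0_pos (hfpos : ∀ m ξ, 0 ≤ f m ξ) (hfint0 : ∀ m, Integrable (f m))
    (hρ : ¬(mom0 f = 0 ∧ mom1 l f = 0 ∧ mom2 f = 0)) : 0 < mom0 f := by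
  refine (Finset.sum_nonneg fun m _ => integral_nonneg (hfpos m)).lt_of_ne' fun h0 => hρ ?_
  have hae : ∀ m, f m =ᵐ[volume] 0 := fun m =>
    (integral_eq_zero_iff_of_nonneg (hfpos m) (hfint0 m)).1
      ((Finset.sum_eq_zero_iff_of_nonneg fun m _ => integral_nonneg (hfpos m)).1 h0 m
        (Finset.mem_univ m))
  have hmul : ∀ (p : ℝ → ℝ) m, ∫ ξ, p ξ * f m ξ = 0 := fun p m => by
    refine integral_eq_zero_of_ae ?_
    filter_upwards [hae m] with ξ hξ
    simp [hξ]
  exact ⟨h0, by simp [mom1, hmul fun ξ => ξ], by simp [mom2, hmul fun ξ => ξ ^ 2 / 2]⟩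

lemma exists_mom1_bound (hfpos : ∀ m ξ, 0 ≤ f m ξ) (hfint0 : ∀ m, Integrable (f m))
    (hfint1 : ∀ m, Integrable fun ξ => ξ * f m ξ)
    (hfint2 : ∀ m, Integrable fun ξ => ξ ^ 2 * f m ξ) (hpos : 0 < mom0 f) :
    ∃ A, A ^ 2 < mom0 f * (2 * mom2 f) ∧
      ∀ w B, (∀ m, |⟪w, l m⟫| ≤ B) → ⟪w, mom1 l f⟫ ≤ B * A := by
  have habs : ∀ m, Integrable fun ξ => |ξ| * f m ξ := fun m =>
    (hfint1 m).abs.congr (Filter.Eventually.of_forall fun ξ => by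
      simp [abs_mul, abs_of_nonneg (hfpos m ξ)])
  have hsum : ∀ p : ℝ → ℝ, (∀ m, Integrable fun ξ => p ξ * f m ξ) →
      ∫ ξ, p ξ * ∑ m, f m ξ = ∑ m, ∫ ξ, p ξ * f m ξ := fun p hp => by
    simp_rw [Finset.mul_sum]
    exact integral_finsetSum _ fun m _ => hp m
  have h0 : ∫ ξ, ∑ m, f m ξ = mom0 f := integral_finsetSum _ fun m _ => hfint0 m
  have h2 : ∫ ξ, ξ ^ 2 * ∑ m, f m ξ = 2 * mom2 f := by
    rw [hsum _ hfint2, mom2, Finset.mul_sum]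
    refine Finset.sum_congr rfl fun m _ => ?_
    rw [← integral_const_mul]
    congr 1
    ext ξ
    ring
  refine ⟨∑ m, ∫ ξ, |ξ| * f m ξ, ?_, fun w B hB => ?_⟩
  · rw [← hsum _ habs, ← h0, ← h2]
    refine sq_integral_abs_mul_lt (fun ξ => Finset.sum_nonneg fun m _ => hfpos m ξ)
      (integrable_finsetSum _ fun m _ => hfint0 m) ?_ ?_ (h0 ▸ hpos)
    · simp_rw [Finset.mul_sum]
      exact integrable_finsetSum _ fun m _ => habs m
    · simp_rw [Finset.mul_sum]
      exact integrable_finsetSum _ fun m _ => hfint2 m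
  · rw [mom1, inner_sum, Finset.mul_sum]
    refine Finset.sum_le_sum fun m _ => ?_
    have h1 : |∫ ξ, ξ * f m ξ| ≤ ∫ ξ, |ξ| * f m ξ := by
      refine (abs_integral_le_integral_abs).trans_eq ?_
      congr 1
      ext ξ
      rw [abs_mul, abs_of_nonneg (hfpos m ξ)]
    rw [real_inner_smul_right, mul_comm B]
    refine (le_abs_self _).trans ?_
    rw [abs_mul]
    exact mul_le_mul h1 (hB m) (abs_nonneg _) ((abs_nonneg _).trans h1)

lemma exists_discEquil_moments_eq (hN : 0 < N)
    (hspan : Submodule.span ℝ (Set.range l) = ⊤)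
    (hfpos : ∀ m ξ, 0 ≤ f m ξ) (hfint0 : ∀ m, Integrable (f m))
    (hfint1 : ∀ m, Integrable fun ξ => ξ * f m ξ)
    (hfint2 : ∀ m, Integrable fun ξ => ξ ^ 2 * f m ξ) (hpos : 0 < mom0 f) :
    ∃ α : ℝ × EuclideanSpace ℝ (Fin D) × ℝ, α.2.2 < 0 ∧
      mom0 (fun m => discEquil (l m) α) = mom0 f ∧
      mom1 l (fun m => discEquil (l m) α) = mom1 l f ∧
      mom2 (fun m => discEquil (l m) α) = mom2 f := by
  obtain ⟨A, hA, hbound⟩ := exists_mom1_bound (l := l) hfpos hfint0 hfint1 hfint2 hpos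
  obtain ⟨w, s, hs, hgrad, hen⟩ := exists_dual_critical_point
    (U := (mom0 f)⁻¹ • mom1 l f) (E := 2 * mom2 f / mom0 f) (K := A / mom0 f) hN hspan
    (by rw [div_pow, div_lt_div_iff₀ (by positivity) hpos]; nlinarith)
    (fun w B hB => by
      rw [real_inner_smul_right, inv_mul_eq_div, mul_div_assoc']
      exact div_le_div_of_nonneg_right (hbound w B hB) hpos.le)
  have hZ := partitionFun_pos l hN w
  set Z := partitionFun l w with hZdef
  have hsq : 0 < √(2 * Real.pi) := by positivity
  set a := Real.log (mom0 f * s / (√(2 * Real.pi) * Z)) with ha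
  have hC : Real.exp a * (√(2 * Real.pi) / s) = mom0 f / Z := by
    rw [ha, Real.exp_log (by positivity)]
    field_simp
  have hC' : ∀ v, Real.exp (a + v ^ 2 / 2) * (√(2 * Real.pi) / s) =
      mom0 f / Z * Real.exp (v ^ 2 / 2) := fun v => by
    rw [← hC, Real.exp_add]
    ring
  have hgauss := fun m => integral_exp_quadratic_moments hs a ⟪w, l m⟫
  refine ⟨(a, s • w, -s ^ 2), by simpa using pow_pos hs 2, ?_, ?_, ?_⟩
  · simp only [mom0, discEquil, real_inner_smul_left, (hgauss _).1, hC']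
    rw [← Finset.mul_sum]
    exact div_mul_cancel₀ _ hZ.ne'
  · simp only [mom1, discEquil, real_inner_smul_left, (hgauss _).2.1, hC']
    have h : ∀ m, (mom0 f / Z * Real.exp (⟪w, l m⟫ ^ 2 / 2) * (⟪w, l m⟫ / s)) • l m =
        (mom0 f / Z / s) • (Real.exp (⟪w, l m⟫ ^ 2 / 2) * ⟪w, l m⟫) • l m := fun m => by
      rw [smul_smul]
      congr 1
      ring
    simp_rw [h]
    rw [← Finset.smul_sum, hgrad, smul_smul (Z * s)]
    have h1 : mom0 f / Z / s * (Z * s * (mom0 f)⁻¹) = 1 := by field_simp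
    rw [smul_smul, h1, one_smul, mom1]
  · simp only [mom2, discEquil, real_inner_smul_left, (hgauss _).2.2, hC']
    have hinner := congrArg (fun x => ⟪w, x⟫) hgrad
    simp only [inner_sum, real_inner_smul_right] at hinner
    rw [real_inner_smul_right] at hen
    have h : ∑ m, mom0 f / Z * Real.exp (⟪w, l m⟫ ^ 2 / 2) * ((1 + ⟪w, l m⟫ ^ 2) / s ^ 2 / 2) =
        mom0 f / Z / s ^ 2 / 2 *
          (Z + ∑ m, Real.exp (⟪w, l m⟫ ^ 2 / 2) * ⟪w, l m⟫ * ⟪w, l m⟫) := by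
      rw [hZdef, partitionFun, ← Finset.sum_add_distrib, Finset.mul_sum]
      refine Finset.sum_congr rfl fun m _ => ?_
      ring
    rw [h, hinner]
    have h1 : Z + Z * s * ((mom0 f)⁻¹ * ⟪w, mom1 l f⟫) = Z * (s ^ 2 * (2 * mom2 f / mom0 f)) := by
      rw [hen]
      ring
    rw [h1, ← mom2]
    field_simp

lemma integrable_pow_mul_discEquil {α : ℝ × EuclideanSpace ℝ (Fin D) × ℝ} (hα : α.2.2 < 0)
    (v : EuclideanSpace ℝ (Fin D)) (n : ℕ) : Integrable fun ξ => ξ ^ n * discEquil v α ξ :=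
  integrable_pow_mul_exp_quadratic hα _ _ n

lemma log_discEquil (v : EuclideanSpace ℝ (Fin D)) (α : ℝ × EuclideanSpace ℝ (Fin D) × ℝ)
    (ξ : ℝ) :
    Real.log (discEquil v α ξ) = α.1 + ξ * ⟪α.2.1, v⟫ + ξ ^ 2 / 2 * α.2.2 :=
  Real.log_exp _

lemma mul_log_discEquil_eq (v : EuclideanSpace ℝ (Fin D))
    (α : ℝ × EuclideanSpace ℝ (Fin D) × ℝ) (g : ℝ → ℝ) :
    (fun ξ => g ξ * Real.log (discEquil v α ξ)) = fun ξ =>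
      α.1 * g ξ + ⟪α.2.1, v⟫ * (ξ * g ξ) + α.2.2 * (ξ ^ 2 / 2 * g ξ) := by
  ext ξ
  rw [log_discEquil]
  ring

lemma integrable_mul_log_discEquil (v : EuclideanSpace ℝ (Fin D))
    (α : ℝ × EuclideanSpace ℝ (Fin D) × ℝ) {g : ℝ → ℝ} (h0 : Integrable g)
    (h1 : Integrable fun ξ => ξ * g ξ) (h2 : Integrable fun ξ => ξ ^ 2 / 2 * g ξ) :
    Integrable fun ξ => g ξ * Real.log (discEquil v α ξ) := by
  rw [mul_log_discEquil_eq]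
  exact ((h0.const_mul _).add (h1.const_mul _)).add (h2.const_mul _)

lemma sum_integral_mul_log_discEquil (α : ℝ × EuclideanSpace ℝ (Fin D) × ℝ)
    (h0 : ∀ m, Integrable (g m)) (h1 : ∀ m, Integrable fun ξ => ξ * g m ξ)
    (h2 : ∀ m, Integrable fun ξ => ξ ^ 2 / 2 * g m ξ) :
    ∑ m, ∫ ξ, g m ξ * Real.log (discEquil (l m) α ξ) =
      α.1 * mom0 g + ⟪α.2.1, mom1 l g⟫ + α.2.2 * mom2 g := by
  rw [mom0, mom1, mom2, inner_sum, Finset.mul_sum, Finset.mul_sum, ← Finset.sum_add_distrib,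
    ← Finset.sum_add_distrib]
  refine Finset.sum_congr rfl fun m _ => ?_
  rw [mul_log_discEquil_eq, integral_linear_combination₃ (h0 m) (h1 m) (h2 m), real_inner_smul_right]
  ring

lemma integrable_discEquil_entropy {α : ℝ × EuclideanSpace ℝ (Fin D) × ℝ} (hα : α.2.2 < 0)
    (v : EuclideanSpace ℝ (Fin D)) :
    Integrable fun ξ => discEquil v α ξ * Real.log (discEquil v α ξ) - discEquil v α ξ := by
  have h0 : Integrable (discEquil v α) := by simpa using integrable_pow_mul_discEquil hα v 0
  refine (integrable_mul_log_discEquil v α h0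
    (by simpa using integrable_pow_mul_discEquil hα v 1) ?_).sub h0
  simpa [div_mul_eq_mul_div] using (integrable_pow_mul_discEquil hα v 2).div_const 2

lemma Hent_discEquil_le {α : ℝ × EuclideanSpace ℝ (Fin D) × ℝ} (hα : α.2.2 < 0)
    (hg : ∀ m ξ, 0 ≤ g m ξ) (hi0 : ∀ m, Integrable (g m))
    (hi1 : ∀ m, Integrable fun ξ => ξ * g m ξ) (hi2 : ∀ m, Integrable fun ξ => ξ ^ 2 * g m ξ)
    (hm0 : mom0 g = mom0 fun m => discEquil (l m) α)
    (hm1 : mom1 l g = mom1 l fun m => discEquil (l m) α)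
    (hm2 : mom2 g = mom2 fun m => discEquil (l m) α)
    (hent : ∀ m, Integrable fun ξ => g m ξ * Real.log (g m ξ) - g m ξ) :
    Hent (fun m => discEquil (l m) α) ≤ Hent g ∧
      (Hent g = Hent (fun m => discEquil (l m) α) ↔
        ∀ m, g m =ᵐ[volume] discEquil (l m) α) := by
  have he0 : ∀ m, Integrable (discEquil (l m) α) := fun m => by
    simpa using integrable_pow_mul_discEquil hα (l m) 0
  have he1 : ∀ m, Integrable fun ξ => ξ * discEquil (l m) α ξ := fun m => by
    simpa using integrable_pow_mul_discEquil hα (l m) 1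
  have he2 : ∀ m, Integrable fun ξ => ξ ^ 2 / 2 * discEquil (l m) α ξ := fun m => by
    simpa [div_mul_eq_mul_div] using (integrable_pow_mul_discEquil hα (l m) 2).div_const 2
  have hi2' : ∀ m, Integrable fun ξ => ξ ^ 2 / 2 * g m ξ := fun m => by
    simpa [div_mul_eq_mul_div] using (hi2 m).div_const 2
  have hgl := fun m => integrable_mul_log_discEquil (l m) α (hi0 m) (hi1 m) (hi2' m)
  have hel := fun m => integrable_mul_log_discEquil (l m) α (he0 m) (he1 m) (he2 m)
  set φ : Fin N → ℝ → ℝ := fun m ξ =>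
    g m ξ * Real.log (g m ξ) - g m ξ - g m ξ * Real.log (discEquil (l m) α ξ) +
      discEquil (l m) α ξ with hφ
  have hφint : ∀ m, Integrable (φ m) := fun m => ((hent m).sub (hgl m)).add (he0 m)
  have hφpos : ∀ m ξ, 0 ≤ φ m ξ := fun m ξ =>
    (relativeEntropy_density_nonneg (hg m ξ) (Real.exp_pos _)).1
  have hdiff : Hent g - Hent (fun m => discEquil (l m) α) = ∑ m, ∫ ξ, φ m ξ := by
    have hcross : ∑ m, ∫ ξ, g m ξ * Real.log (discEquil (l m) α ξ) =
        ∑ m, ∫ ξ, discEquil (l m) α ξ * Real.log (discEquil (l m) α ξ) := by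
      rw [sum_integral_mul_log_discEquil α hi0 hi1 hi2', hm0, hm1, hm2,
        sum_integral_mul_log_discEquil α he0 he1 he2]
    have h1 : ∀ m, ∫ ξ, φ m ξ = (∫ ξ, (g m ξ * Real.log (g m ξ) - g m ξ)) -
        (∫ ξ, g m ξ * Real.log (discEquil (l m) α ξ)) + ∫ ξ, discEquil (l m) α ξ := fun m => by
      rw [← integral_sub (hent m) (hgl m)]
      exact integral_add ((hent m).sub (hgl m)) (he0 m)
    have h2 : Hent (fun m => discEquil (l m) α) =
        (∑ m, ∫ ξ, discEquil (l m) α ξ * Real.log (discEquil (l m) α ξ)) -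
          ∑ m, ∫ ξ, discEquil (l m) α ξ := by
      rw [Hent, ← Finset.sum_sub_distrib]
      exact Finset.sum_congr rfl fun m _ => integral_sub (hel m) (he0 m)
    simp_rw [h1]
    rw [Finset.sum_add_distrib, Finset.sum_sub_distrib, hcross, h2, Hent]
    ring
  have hint : ∀ m, 0 ≤ ∫ ξ, φ m ξ := fun m => integral_nonneg (hφpos m)
  refine ⟨?_, fun heq m => ?_, fun hae => ?_⟩
  · linarith [Finset.sum_nonneg fun m (_ : m ∈ Finset.univ) => hint m]
  · rw [heq, sub_self, eq_comm, Finset.sum_eq_zero_iff_of_nonneg fun m _ => hint m] at hdiff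
    have h := (integral_eq_zero_iff_of_nonneg (hφpos m) (hφint m)).1
      (hdiff m (Finset.mem_univ m))
    filter_upwards [h] with ξ hξ
    exact (relativeEntropy_density_nonneg (hg m ξ) (Real.exp_pos _)).2 hξ
  · refine Finset.sum_congr rfl fun m _ => integral_congr_ae ?_
    filter_upwards [hae m] with ξ hξ
    rw [hξ]

lemma eq_of_discEquil_ae_eq (hN : 0 < N) (hspan : Submodule.span ℝ (Set.range l) = ⊤)
    {α β : ℝ × EuclideanSpace ℝ (Fin D) × ℝ}
    (h : ∀ m, discEquil (l m) α =ᵐ[volume] discEquil (l m) β) : α = β := by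
  have hcont : ∀ v (γ : ℝ × EuclideanSpace ℝ (Fin D) × ℝ), Continuous (discEquil v γ) :=
    fun v γ => by unfold discEquil; fun_prop
  have heq : ∀ m (ξ : ℝ), α.1 + ξ * ⟪α.2.1, l m⟫ + ξ ^ 2 / 2 * α.2.2 =
      β.1 + ξ * ⟪β.2.1, l m⟫ + ξ ^ 2 / 2 * β.2.2 := fun m ξ => by
    rw [← log_discEquil, ← log_discEquil,
      ((hcont _ _).ae_eq_iff_eq volume (hcont _ _)).1 (h m)]
  refine Prod.ext ?_ (Prod.ext (eq_of_forall_inner_eq hspan fun m => ?_) ?_)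
  · linarith [heq ⟨0, hN⟩ 0]
  · linarith [heq m 1, heq m (-1)]
  · linarith [heq ⟨0, hN⟩ 0, heq ⟨0, hN⟩ 1, heq ⟨0, hN⟩ (-1)]

end DiscreteMoments

/-- for a nonnegative measurable `N`-tuple `f` with finite moments
`ρ = ⟨m(ξ) f⟩ ≠ 0`, there is a unique `α` with `α_{D+1} < 0` such that the
exponential tuple `𝓔` has the same moments; moreover this `𝓔` is the unique
minimizer of the discrete entropy among nonnegative tuples with the moments `ρ`
and finite entropy. -/
theorem stmt_0
    (D N : ℕ) (hD : 2 ≤ D) (hN : D ≤ N)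
    (l : Fin N → EuclideanSpace ℝ (Fin D)) (hl : ∀ m, ‖l m‖ = 1)
    (hrank : Submodule.span ℝ (Set.range l) = ⊤)
    (f : Fin N → ℝ → ℝ)
    (hfmeas : ∀ m, Measurable (f m)) (hfpos : ∀ m ξ, 0 ≤ f m ξ)
    (hfint0 : ∀ m, Integrable (f m))
    (hfint1 : ∀ m, Integrable fun ξ => ξ * f m ξ)
    (hfint2 : ∀ m, Integrable fun ξ => ξ ^ 2 * f m ξ)
    (hρ : ¬(mom0 f = 0 ∧ mom1 l f = 0 ∧ mom2 f = 0)) :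
    (∃! α : ℝ × EuclideanSpace ℝ (Fin D) × ℝ, α.2.2 < 0 ∧
        mom0 (fun m => discEquil (l m) α) = mom0 f ∧
        mom1 l (fun m => discEquil (l m) α) = mom1 l f ∧
        mom2 (fun m => discEquil (l m) α) = mom2 f) ∧
    (∀ α : ℝ × EuclideanSpace ℝ (Fin D) × ℝ, α.2.2 < 0 →
      mom0 (fun m => discEquil (l m) α) = mom0 f →
      mom1 l (fun m => discEquil (l m) α) = mom1 l f →
      mom2 (fun m => discEquil (l m) α) = mom2 f →
      ∀ g : Fin N → ℝ → ℝ, (∀ m, Measurable (g m)) → (∀ m ξ, 0 ≤ g m ξ) →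
        (∀ m, Integrable (g m)) →
        (∀ m, Integrable fun ξ => ξ * g m ξ) →
        (∀ m, Integrable fun ξ => ξ ^ 2 * g m ξ) →
        mom0 g = mom0 f → mom1 l g = mom1 l f → mom2 g = mom2 f →
        (∀ m, Integrable fun ξ => g m ξ * Real.log (g m ξ) - g m ξ) →
        Hent (fun m => discEquil (l m) α) ≤ Hent g ∧
          (Hent g = Hent (fun m => discEquil (l m) α) ↔
            ∀ m, g m =ᵐ[volume] discEquil (l m) α)) := by
  have hN0 : 0 < N := by omega
  obtain ⟨α, hα, h0, h1, h2⟩ := exists_discEquil_moments_eq hN0 hrank hfpos hfint0 hfint1 hfint2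
    (mom0_pos hfpos hfint0 hρ)
  refine ⟨⟨α, ⟨hα, h0, h1, h2⟩, ?_⟩, ?_⟩
  · rintro β ⟨hβ, k0, k1, k2⟩
    have hle : ∀ {γ ε : ℝ × EuclideanSpace ℝ (Fin D) × ℝ}, γ.2.2 < 0 → ε.2.2 < 0 →
        mom0 (fun m => discEquil (l m) ε) = mom0 (fun m => discEquil (l m) γ) →
        mom1 l (fun m => discEquil (l m) ε) = mom1 l (fun m => discEquil (l m) γ) →
        mom2 (fun m => discEquil (l m) ε) = mom2 (fun m => discEquil (l m) γ) →
        _ := fun {γ ε} hγ hε e0 e1 e2 =>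
      Hent_discEquil_le (g := fun m => discEquil (l m) ε) hγ (fun _ _ => (Real.exp_pos _).le)
        (fun m => by simpa using integrable_pow_mul_discEquil hε (l m) 0)
        (fun m => by simpa using integrable_pow_mul_discEquil hε (l m) 1)
        (fun m => integrable_pow_mul_discEquil hε (l m) 2) e0 e1 e2
        (fun m => integrable_discEquil_entropy hε (l m))
    have hαβ := hle hα hβ (k0.trans h0.symm) (k1.trans h1.symm) (k2.trans h2.symm)
    have hβα := hle hβ hα (h0.trans k0.symm) (h1.trans k1.symm) (h2.trans k2.symm)
    exact eq_of_discEquil_ae_eq hN0 hrank (hαβ.2.1 (le_antisymm hβα.1 hαβ.1))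
  · intro α hα h0 h1 h2 g _ hg hi0 hi1 hi2 k0 k1 k2 hent
    exact Hent_discEquil_le hα hg hi0 hi1 hi2 (k0.trans h0.symm) (k1.trans h1.symm)
      (k2.trans h2.symm) hent
end

section
/- Suppose ρ = (ρ, ρU, ρE) ∈ ℝ × ℝ^D × ℝ satisfies ρ > 0, E > 0, and, in case U := |U| ≠ 0, E > (1/2) U² s_min(U/|U|)². Then the function J attains its minimum on 𝒟: there exists α* ∈ 𝒟 such that J(α*) ≤ J(α) for all α ∈ 𝒟. -/
open scoped RealInnerProductSpace
open MeasureTheory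

/-- The function `J(α) = Σ_m √(2π/(−α_{D+1})) exp(α₀ + ⟪α̂, l m⟫²/(2(−α_{D+1})))
− (ρ α₀ + ρU·α̂ + ρE α_{D+1})`, for `ρ = (r, rU, rE) ∈ ℝ × ℝᴰ × ℝ` and
`α = (α₀, α̂, α_{D+1})`. -/
noncomputable def Jfun {D N : ℕ} (l : Fin N → EuclideanSpace ℝ (Fin D))
    (r : ℝ) (rU : EuclideanSpace ℝ (Fin D)) (rE : ℝ)
    (α : ℝ × EuclideanSpace ℝ (Fin D) × ℝ) : ℝ :=
  (∑ m, Real.sqrt (2 * Real.pi / (-α.2.2)) *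
      Real.exp (α.1 + ⟪α.2.1, l m⟫ ^ 2 / (2 * (-α.2.2))))
    - (r * α.1 + ⟪rU, α.2.1⟫ + rE * α.2.2)

/-- `s_min(e) = inf { Σ_m |a_m| : Σ_m a_m l_m = e }`. -/
noncomputable def smin {D N : ℕ} (l : Fin N → EuclideanSpace ℝ (Fin D))
    (e : EuclideanSpace ℝ (Fin D)) : ℝ :=
  sInf {s : ℝ | ∃ a : Fin N → ℝ, (∑ m, a m • l m) = e ∧ s = ∑ m, |a m|}

/-- `eʸ - r y` grows at least linearly in `|y|`. -/
lemma mul_abs_le_exp_sub_mul {r : ℝ} (hr : 0 < r) (y : ℝ) :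
    r * |y| ≤ Real.exp y - r * y + 2 * r * |1 - Real.log (2 * r)| := by
  have h2r : 0 < 2 * r := by positivity
  have hexp : Real.exp y = 2 * r * Real.exp (y - Real.log (2 * r)) := by
    rw [Real.exp_sub, Real.exp_log h2r]
    field_simp
  have hlin := mul_le_mul_of_nonneg_left (Real.add_one_le_exp (y - Real.log (2 * r))) h2r.le
  have hneg := mul_le_mul_of_nonneg_left (neg_abs_le (1 - Real.log (2 * r))) h2r.le
  have hnonneg : 0 ≤ 2 * r * |1 - Real.log (2 * r)| := by positivity
  have hpos := Real.exp_pos y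
  rcases abs_cases y with ⟨h, -⟩ | ⟨h, -⟩ <;> rw [h] <;> nlinarith

/-- `δ b - ½ log b` grows at least linearly in `|log b|`. -/
lemma half_abs_log_le {δ b : ℝ} (hδ : 0 < δ) (hb : 0 < b) :
    1 / 2 * |Real.log b| ≤ δ * b - 1 / 2 * Real.log b + |1 + Real.log δ| := by
  have hlog := Real.log_le_sub_one_of_pos (mul_pos hδ hb)
  rw [Real.log_mul hδ.ne' hb.ne'] at hlog
  have hneg := neg_abs_le (1 + Real.log δ)
  have hnonneg := abs_nonneg (1 + Real.log δ)
  have hpos := mul_pos hδ hb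
  rcases abs_cases (Real.log b) with ⟨h, -⟩ | ⟨h, -⟩ <;> rw [h] <;> linarith

/-- Completing the square and taking the logarithm of the prefactor separates the variables. -/
lemma gaussian_sub_linear_eq {b : ℝ} (hb : 0 < b) (r s E x p : ℝ) :
    Real.sqrt (2 * Real.pi / b) * Real.exp (x + p ^ 2 / (2 * b)) - (r * x + r * s * p - r * E * b)
      = Real.exp (1 / 2 * Real.log (2 * Real.pi) - 1 / 2 * Real.log b + x + p ^ 2 / (2 * b))
        - r * (1 / 2 * Real.log (2 * Real.pi) - 1 / 2 * Real.log b + x + p ^ 2 / (2 * b))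
        + r * (1 / 2 * Real.log (2 * Real.pi) + (p - s * b) ^ 2 / (2 * b)
          + ((E - s ^ 2 / 2) * b - 1 / 2 * Real.log b)) := by
  have hq : 0 < 2 * Real.pi / b := by positivity
  have hsqrt : Real.sqrt (2 * Real.pi / b)
      = Real.exp (1 / 2 * Real.log (2 * Real.pi) - 1 / 2 * Real.log b) := by
    rw [← Real.exp_log (Real.sqrt_pos.2 hq), Real.log_sqrt hq.le,
      Real.log_div (by positivity) hb.ne']
    congr 1
    ring
  rw [hsqrt, ← Real.exp_add, ← add_assoc]
  field_simp
  ring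

/-- Sublevel sets of the scalar minorant are bounded in `x`, `p` and `log b`. -/
lemma exists_bound_of_gaussian_sub_linear_le {r s E : ℝ} (hr : 0 < r) (hs : s ^ 2 / 2 < E)
    (C : ℝ) :
    ∃ R : ℝ, ∀ x p b : ℝ, 0 < b →
      Real.sqrt (2 * Real.pi / b) * Real.exp (x + p ^ 2 / (2 * b))
        - (r * x + r * s * p - r * E * b) ≤ C →
      |x| ≤ R ∧ |p| ≤ R ∧ |Real.log b| ≤ R := by
  have hδ : 0 < E - s ^ 2 / 2 := by linarith
  set k := 1 / 2 * Real.log (2 * Real.pi) with hk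
  set A := 2 * r * |1 - Real.log (2 * r)| with hA
  set B := |1 + Real.log (E - s ^ 2 / 2)| with hB
  set G := C + A + r * B - r * k with hG
  set L := 2 * G / r with hL
  set P := 2 * Real.exp L * (G / r) + 1 + |s| * Real.exp L with hP
  set X := G / r + |k| + 1 / 2 * L + P ^ 2 / 2 * Real.exp L with hX
  clear_value X P L G B A
  refine ⟨max X (max P L), fun x p b hb h => ?_⟩
  rw [gaussian_sub_linear_eq hb, ← hk] at h
  clear_value k
  set y := k - 1 / 2 * Real.log b + x + p ^ 2 / (2 * b) with hy
  clear_value y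
  have hexp := mul_abs_le_exp_sub_mul hr y
  have hlog := mul_le_mul_of_nonneg_left (half_abs_log_le hδ hb) hr.le
  have hsum : r * |y| + r * ((p - s * b) ^ 2 / (2 * b)) + r * (1 / 2 * |Real.log b|) ≤ G := by
    rw [hG, hA, hB]
    linarith
  have hy0 : 0 ≤ r * |y| := by positivity
  have hsq0 : 0 ≤ r * ((p - s * b) ^ 2 / (2 * b)) := by positivity
  have hlog0 : 0 ≤ r * (1 / 2 * |Real.log b|) := by positivity
  have hyG : |y| ≤ G / r := by rw [le_div_iff₀ hr]; linarith
  have hsqG : (p - s * b) ^ 2 / (2 * b) ≤ G / r := by rw [le_div_iff₀ hr]; linarith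
  have hlogL : |Real.log b| ≤ L := by rw [hL, le_div_iff₀ hr]; linarith
  have hG0 : 0 ≤ G / r := (abs_nonneg y).trans hyG
  have hbL : b ≤ Real.exp L := by
    rw [← Real.log_le_iff_le_exp hb]
    exact (le_abs_self _).trans hlogL
  have hbinv : b⁻¹ ≤ Real.exp L := by
    rw [← Real.log_le_iff_le_exp (inv_pos.2 hb), Real.log_inv]
    exact (neg_le_abs _).trans hlogL
  have hpP : |p| ≤ P := by
    rw [div_le_iff₀ (by positivity)] at hsqG
    have h1 : G / r * (2 * b) ≤ 2 * Real.exp L * (G / r) := by nlinarith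
    have h2 : |p - s * b| ≤ 2 * Real.exp L * (G / r) + 1 := by
      have h3 := sq_abs (p - s * b)
      nlinarith [abs_nonneg (p - s * b)]
    have h4 : |s * b| ≤ |s| * Real.exp L := by
      rw [abs_mul, abs_of_pos hb]
      gcongr
    have h5 := abs_add_le (p - s * b) (s * b)
    rw [sub_add_cancel] at h5
    linarith
  have hxX : |x| ≤ X := by
    have h1 : p ^ 2 / (2 * b) ≤ P ^ 2 / 2 * Real.exp L := by
      have h2 : p ^ 2 / (2 * b) = p ^ 2 / 2 * b⁻¹ := by rw [← div_div, div_eq_mul_inv]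
      rw [h2]
      have h3 : p ^ 2 ≤ P ^ 2 := by
        rw [← sq_abs p]
        gcongr
      gcongr
    have h0 : 0 ≤ p ^ 2 / (2 * b) := by positivity
    have hyb := abs_le.1 hyG
    have hlb := abs_le.1 hlogL
    have hkb := abs_le.1 (le_refl |k|)
    rw [abs_le, hX]
    constructor <;> linarith [hyb.1, hyb.2, hlb.1, hlb.2, hkb.1, hkb.2]
  exact ⟨hxX.trans (le_max_left _ _), hpP.trans ((le_max_left _ _).trans (le_max_right _ _)),
    hlogL.trans ((le_max_right _ _).trans (le_max_right _ _))⟩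

/-- If `½‖U‖² s_min(U/‖U‖)² < E`, then `U` has a representation over `l` whose `ℓ¹` norm `s`
satisfies `s² / 2 < E`. -/
lemma exists_representation_sq_lt {D N : ℕ} {l : Fin N → EuclideanSpace ℝ (Fin D)}
    (hrank : Submodule.span ℝ (Set.range l) = ⊤) {E : ℝ} {U : EuclideanSpace ℝ (Fin D)}
    (hE : 0 < E) (hU : U ≠ 0 → 1 / 2 * ‖U‖ ^ 2 * smin l (‖U‖⁻¹ • U) ^ 2 < E) :
    ∃ a : Fin N → ℝ, ∑ m, a m • l m = U ∧ (∑ m, |a m|) ^ 2 / 2 < E := by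
  by_cases h0 : U = 0
  · exact ⟨0, by simp [h0], by simpa using hE⟩
  have hpos : 0 < ‖U‖ := norm_pos_iff.2 h0
  have hlt : smin l (‖U‖⁻¹ • U) < Real.sqrt (2 * E) / ‖U‖ := by
    rw [lt_div_iff₀ hpos]
    apply Real.lt_sqrt_of_sq_lt
    have := hU h0
    nlinarith
  have hmem : ‖U‖⁻¹ • U ∈ Submodule.span ℝ (Set.range l) := hrank ▸ Submodule.mem_top
  obtain ⟨c, hc⟩ := (Submodule.mem_span_range_iff_exists_fun ℝ).1 hmem
  have hne : {s : ℝ | ∃ a : Fin N → ℝ, ∑ m, a m • l m = ‖U‖⁻¹ • U ∧ s = ∑ m, |a m|}.Nonempty :=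
    ⟨_, c, hc, rfl⟩
  obtain ⟨s, ⟨a, ha, rfl⟩, hs⟩ := exists_lt_of_csInf_lt hne hlt
  refine ⟨fun m => ‖U‖ * a m, ?_, ?_⟩
  · simp_rw [mul_smul, ← Finset.smul_sum, ha, smul_smul, mul_inv_cancel₀ hpos.ne', one_smul]
  · simp_rw [abs_mul, abs_norm, ← Finset.mul_sum]
    rw [lt_div_iff₀ hpos] at hs
    have := (Real.lt_sqrt (by positivity)).1 hs
    rw [mul_comm]
    linarith

/-- A spanning family bounds the norm by the largest inner product with a member. -/
lemma exists_norm_le_mul_abs_inner {D N : ℕ} [Nonempty (Fin N)]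
    {l : Fin N → EuclideanSpace ℝ (Fin D)} (hrank : Submodule.span ℝ (Set.range l) = ⊤) :
    ∃ K : ℝ, 0 ≤ K ∧ ∀ x : EuclideanSpace ℝ (Fin D), ∃ m,
      (∀ i, |⟪x, l i⟫| ≤ |⟪x, l m⟫|) ∧ ‖x‖ ≤ K * |⟪x, l m⟫| := by
  let T : EuclideanSpace ℝ (Fin D) →ₗ[ℝ] (Fin N → ℝ) :=
    LinearMap.pi fun m => (innerₗ (EuclideanSpace ℝ (Fin D))) (l m)
  have hT : ∀ x m, T x m = ⟪x, l m⟫ := fun x m => real_inner_comm x (l m)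
  have hker : LinearMap.ker T = ⊥ := by
    rw [LinearMap.ker_eq_bot']
    intro x hx
    have hspan : x ∈ Submodule.span ℝ (Set.range l) := hrank ▸ Submodule.mem_top
    obtain ⟨c, hc⟩ := (Submodule.mem_span_range_iff_exists_fun ℝ).1 hspan
    rw [← inner_self_eq_zero (𝕜 := ℝ)]
    conv_lhs => rw [← hc, inner_sum]
    refine Finset.sum_eq_zero fun m _ => ?_
    rw [hc, real_inner_smul_right, ← hT, hx, Pi.zero_apply, mul_zero]
  obtain ⟨K, -, hK⟩ := T.exists_antilipschitzWith hker
  refine ⟨K, K.2, fun x => ?_⟩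
  obtain ⟨m, hm⟩ := Finite.exists_max fun i => |⟪x, l i⟫|
  refine ⟨m, hm, ?_⟩
  have hbound := hK.le_mul_dist x 0
  rw [map_zero, dist_zero_right, dist_zero_right] at hbound
  refine hbound.trans (mul_le_mul_of_nonneg_left ?_ K.2)
  rw [pi_norm_le_iff_of_nonneg (abs_nonneg _)]
  intro i
  rw [hT, Real.norm_eq_abs]
  exact hm i

/-- `J` is bounded below by its scalar minorant at the dominant direction `m`. -/
lemma gaussian_sub_linear_le_Jfun {D N : ℕ} {l : Fin N → EuclideanSpace ℝ (Fin D)} {r E : ℝ}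
    (hr : 0 < r) (a : Fin N → ℝ) {α : ℝ × EuclideanSpace ℝ (Fin D) × ℝ} {m : Fin N}
    (hm : ∀ i, |⟪α.2.1, l i⟫| ≤ |⟪α.2.1, l m⟫|) :
    Real.sqrt (2 * Real.pi / (-α.2.2)) * Real.exp (α.1 + |⟪α.2.1, l m⟫| ^ 2 / (2 * (-α.2.2)))
        - (r * α.1 + r * (∑ i, |a i|) * |⟪α.2.1, l m⟫| - r * E * (-α.2.2))
      ≤ Jfun l r (r • ∑ i, a i • l i) (r * E) α := by
  have hinner : ⟪r • ∑ i, a i • l i, α.2.1⟫ ≤ r * (∑ i, |a i|) * |⟪α.2.1, l m⟫| := by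
    rw [real_inner_smul_left, sum_inner, mul_assoc, Finset.sum_mul]
    refine mul_le_mul_of_nonneg_left (Finset.sum_le_sum fun i _ => ?_) hr.le
    rw [real_inner_smul_left, real_inner_comm]
    refine (le_abs_self _).trans ?_
    rw [abs_mul]
    exact mul_le_mul_of_nonneg_left (hm i) (abs_nonneg _)
  have hsum : Real.sqrt (2 * Real.pi / (-α.2.2))
        * Real.exp (α.1 + |⟪α.2.1, l m⟫| ^ 2 / (2 * (-α.2.2)))
      ≤ ∑ i, Real.sqrt (2 * Real.pi / (-α.2.2))
        * Real.exp (α.1 + ⟪α.2.1, l i⟫ ^ 2 / (2 * (-α.2.2))) := by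
    rw [sq_abs]
    exact Finset.single_le_sum (f := fun i => Real.sqrt (2 * Real.pi / (-α.2.2))
      * Real.exp (α.1 + ⟪α.2.1, l i⟫ ^ 2 / (2 * (-α.2.2))))
      (fun i _ => by positivity) (Finset.mem_univ m)
  unfold Jfun
  linarith

lemma continuousOn_Jfun {D N : ℕ} (l : Fin N → EuclideanSpace ℝ (Fin D)) (r : ℝ)
    (rU : EuclideanSpace ℝ (Fin D)) (rE : ℝ) :
    ContinuousOn (Jfun l r rU rE) {α | α.2.2 < 0} := by
  have hne : ∀ α ∈ {α : ℝ × EuclideanSpace ℝ (Fin D) × ℝ | α.2.2 < 0}, -α.2.2 ≠ 0 :=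
    fun α hα => (neg_pos.2 hα).ne'
  have hne' : ∀ α ∈ {α : ℝ × EuclideanSpace ℝ (Fin D) × ℝ | α.2.2 < 0}, 2 * -α.2.2 ≠ 0 :=
    fun α hα => mul_ne_zero two_ne_zero (hne α hα)
  unfold Jfun
  fun_prop (disch := assumption)

/-- if `ρ = (ρ, ρU, ρE)` with `ρ > 0`, `E > 0` and (when `U ≠ 0`)
`E > ½|U|² s_min(U/|U|)²`, then `J` attains its minimum on
`𝒟 = {α : α_{D+1} < 0}`. -/
theorem stmt_1
    (D N : ℕ) (hD : 2 ≤ D) (hN : D ≤ N)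
    (l : Fin N → EuclideanSpace ℝ (Fin D)) (hl : ∀ m, ‖l m‖ = 1)
    (hrank : Submodule.span ℝ (Set.range l) = ⊤)
    (r E : ℝ) (U : EuclideanSpace ℝ (Fin D))
    (hr : 0 < r) (hE : 0 < E)
    (hU : U ≠ 0 → 1 / 2 * ‖U‖ ^ 2 * smin l (‖U‖⁻¹ • U) ^ 2 < E) :
    ∃ αs : ℝ × EuclideanSpace ℝ (Fin D) × ℝ, αs.2.2 < 0 ∧
      ∀ α : ℝ × EuclideanSpace ℝ (Fin D) × ℝ, α.2.2 < 0 →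
        Jfun l r (r • U) (r * E) αs ≤ Jfun l r (r • U) (r * E) α := by
  have : Nonempty (Fin N) := ⟨⟨0, by omega⟩⟩
  obtain ⟨a, rfl, hs⟩ := exists_representation_sq_lt hrank hE hU
  obtain ⟨K, hK0, hK⟩ := exists_norm_le_mul_abs_inner hrank
  set J := Jfun l r (r • ∑ i, a i • l i) (r * E)
  let base : ℝ × EuclideanSpace ℝ (Fin D) × ℝ := (0, 0, -1)
  obtain ⟨R, hR⟩ := exists_bound_of_gaussian_sub_linear_le hr hs (J base)
  let S : Set (ℝ × EuclideanSpace ℝ (Fin D) × ℝ) :=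
    Set.Icc (-R) R ×ˢ Metric.closedBall 0 (K * R) ×ˢ Set.Icc (-Real.exp R) (-Real.exp (-R))
  have hS : IsCompact S :=
    isCompact_Icc.prod ((isCompact_closedBall _ _).prod isCompact_Icc)
  have hneg : ∀ α ∈ S, α.2.2 < 0 := fun α hα =>
    hα.2.2.2.trans_lt (neg_lt_zero.2 (Real.exp_pos _))
  have hsub : ∀ α : ℝ × EuclideanSpace ℝ (Fin D) × ℝ, α.2.2 < 0 → J α ≤ J base → α ∈ S := by
    intro α hα hle
    have hb : 0 < -α.2.2 := neg_pos.2 hα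
    obtain ⟨m, hm, hnorm⟩ := hK α.2.1
    obtain ⟨hx, hp, hlog⟩ := hR _ _ _ hb ((gaussian_sub_linear_le_Jfun hr a hm).trans hle)
    rw [abs_abs] at hp
    rw [abs_le, Real.le_log_iff_exp_le hb, Real.log_le_iff_le_exp hb] at hlog
    refine ⟨abs_le.1 hx, ?_, ?_, ?_⟩
    · rw [mem_closedBall_zero_iff]
      exact hnorm.trans (mul_le_mul_of_nonneg_left hp hK0)
    · linarith [hlog.2]
    · linarith [hlog.1]
  have hbase : base ∈ S := hsub base (by simp [base]) le_rfl
  obtain ⟨αs, hαs, hmin⟩ :=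
    hS.exists_isMinOn ⟨base, hbase⟩ ((continuousOn_Jfun l r _ (r * E)).mono hneg)
  refine ⟨αs, hneg αs hαs, fun α hα => ?_⟩
  rcases le_total (J α) (J base) with h | h
  · exact hmin (hsub α hα h)
  · exact (hmin hbase).trans h
end

section
/- Let ρ ∈ ℝ^{D+2} and let α ∈ ℝ^{D+2} with last component α_{D+1} < 0 satisfy the moment equations Σ_{m=1}^N ∫_ℝ m_m(ξ) exp(α · m_m(ξ)) dξ = ρ. Set 𝓔_m(ξ) = exp(α · m_m(ξ)). Then for every N-tuple g = (g_1,…,g_N) of nonnegative measurable functions on ℝ with ⟨m(ξ) g⟩ = ρ and H[g] finite, one has H[g] ≥ H[𝓔], with equality if and only if g_m = 𝓔_m almost everywhere for every m. -/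
open scoped RealInnerProductSpace
open MeasureTheory

/-- The exponent `α ⬝ m_m ξ` of the discrete equilibrium. -/
noncomputable def discExponent {D : ℕ} (lm : EuclideanSpace ℝ (Fin D))
    (α : ℝ × EuclideanSpace ℝ (Fin D) × ℝ) (ξ : ℝ) : ℝ :=
  α.1 + ξ * ⟪α.2.1, lm⟫ + ξ ^ 2 / 2 * α.2.2

lemma discEquil_eq_exp {D : ℕ} (lm : EuclideanSpace ℝ (Fin D))
    (α : ℝ × EuclideanSpace ℝ (Fin D) × ℝ) (ξ : ℝ) :
    discEquil lm α ξ = Real.exp (discExponent lm α ξ) := rfl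

lemma integrable_exp_quadratic {c : ℝ} (hc : c < 0) (a b : ℝ) :
    Integrable fun x : ℝ => Real.exp (a + x * b + x ^ 2 / 2 * c) := by
  have h := (integrable_cexp_quadratic' (b := ((c / 2 : ℝ) : ℂ))
    (by rw [Complex.ofReal_re]; linarith) (b : ℂ) (a : ℂ)).norm
  refine h.congr (Filter.Eventually.of_forall fun x => ?_)
  simp only [Complex.norm_exp]
  congr 1
  have : ((c / 2 : ℝ) : ℂ) * (x : ℂ) ^ 2 + (b : ℂ) * (x : ℂ) + (a : ℂ)
      = ((a + x * b + x ^ 2 / 2 * c : ℝ) : ℂ) := by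
    push_cast
    ring
  rw [this, Complex.ofReal_re]

lemma integrable_sq_mul_exp_quadratic {c : ℝ} (hc : c < 0) (a b : ℝ) :
    Integrable fun x : ℝ => x ^ 2 * Real.exp (a + x * b + x ^ 2 / 2 * c) := by
  refine ((integrable_exp_quadratic (c := c / 2) (by linarith) a b).const_mul (4 / -c)).mono'
    (by fun_prop) (Filter.Eventually.of_forall fun x => ?_)
  rw [Real.norm_of_nonneg (by positivity)]
  have hsplit : Real.exp (a + x * b + x ^ 2 / 2 * (c / 2))
      = Real.exp (-c / 4 * x ^ 2) * Real.exp (a + x * b + x ^ 2 / 2 * c) := by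
    rw [← Real.exp_add]
    congr 1
    ring
  rw [hsplit, ← mul_assoc]
  refine mul_le_mul_of_nonneg_right ?_ (Real.exp_pos _).le
  have h := Real.add_one_le_exp (-c / 4 * x ^ 2)
  rw [div_mul_eq_mul_div, le_div_iff₀ (by linarith)]
  linarith

/-- A function with integrable zeroth and second moments has an integrable first moment. -/
lemma integrable_id_mul_of_integrable_sq_mul {f : ℝ → ℝ} (hf : Integrable f)
    (hf2 : Integrable fun x => x ^ 2 * f x) : Integrable fun x => x * f x := by
  refine (hf.norm.add hf2.norm).mono' (by fun_prop) (Filter.Eventually.of_forall fun x => ?_)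
  simp only [Pi.add_apply, norm_mul, norm_pow]
  nlinarith [norm_nonneg (f x), mul_nonneg (norm_nonneg (f x)) (sq_nonneg (‖x‖ - 1)),
    mul_nonneg (norm_nonneg (f x)) (sq_nonneg ‖x‖)]

section Moments

variable {D : ℕ} (lm : EuclideanSpace ℝ (Fin D)) (α : ℝ × EuclideanSpace ℝ (Fin D) × ℝ)

lemma discExponent_mul_eq (f : ℝ → ℝ) :
    (fun ξ => discExponent lm α ξ * f ξ) = fun ξ =>
      α.1 * f ξ + ⟪α.2.1, lm⟫ * (ξ * f ξ) + α.2.2 * (ξ ^ 2 / 2 * f ξ) := by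
  funext ξ
  rw [discExponent]
  ring

variable {f : ℝ → ℝ}

lemma integrable_sq_div_two_mul (hf2 : Integrable fun ξ => ξ ^ 2 * f ξ) :
    Integrable fun ξ => ξ ^ 2 / 2 * f ξ := by
  refine (hf2.div_const 2).congr (Filter.Eventually.of_forall fun ξ => ?_)
  ring

lemma integrable_discExponent_mul (hf : Integrable f) (hf1 : Integrable fun ξ => ξ * f ξ)
    (hf2 : Integrable fun ξ => ξ ^ 2 * f ξ) :
    Integrable fun ξ => discExponent lm α ξ * f ξ := by
  rw [discExponent_mul_eq]
  exact ((hf.const_mul _).add (hf1.const_mul _)).add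
    ((integrable_sq_div_two_mul hf2).const_mul _)

lemma integral_discExponent_mul (hf : Integrable f) (hf1 : Integrable fun ξ => ξ * f ξ)
    (hf2 : Integrable fun ξ => ξ ^ 2 * f ξ) :
    ∫ ξ, discExponent lm α ξ * f ξ = α.1 * (∫ ξ, f ξ) + ⟪α.2.1, lm⟫ * (∫ ξ, ξ * f ξ)
      + α.2.2 * ∫ ξ, ξ ^ 2 / 2 * f ξ := by
  have h01 : Integrable fun ξ => α.1 * f ξ + ⟪α.2.1, lm⟫ * (ξ * f ξ) :=
    (hf.const_mul _).add (hf1.const_mul _)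
  rw [discExponent_mul_eq, integral_add h01 ((integrable_sq_div_two_mul hf2).const_mul _),
    integral_add (hf.const_mul _) (hf1.const_mul _)]
  simp only [integral_const_mul]

end Moments

lemma sum_integral_discExponent_mul {D N : ℕ} (l : Fin N → EuclideanSpace ℝ (Fin D))
    (α : ℝ × EuclideanSpace ℝ (Fin D) × ℝ) {g : Fin N → ℝ → ℝ} (hg : ∀ m, Integrable (g m))
    (hg1 : ∀ m, Integrable fun ξ => ξ * g m ξ)
    (hg2 : ∀ m, Integrable fun ξ => ξ ^ 2 * g m ξ) :
    ∑ m, ∫ ξ, discExponent (l m) α ξ * g m ξ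
      = α.1 * mom0 g + ⟪α.2.1, mom1 l g⟫ + α.2.2 * mom2 g := by
  simp only [mom0, mom1, mom2, inner_sum, inner_smul_right, Finset.mul_sum,
    ← Finset.sum_add_distrib]
  refine Finset.sum_congr rfl fun m _ => ?_
  rw [integral_discExponent_mul (l m) α (hg m) (hg1 m) (hg2 m)]
  ring

/-- The Bregman divergence of `y ln y - y` between `y` and `exp L`. -/
noncomputable def entropyDivergence (L y : ℝ) : ℝ :=
  y * Real.log y - y - L * y + Real.exp L

lemma entropyDivergence_exp (L : ℝ) : entropyDivergence L (Real.exp L) = 0 := by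
  rw [entropyDivergence, Real.log_exp]
  ring

lemma entropyDivergence_pos {L y : ℝ} (hy : 0 ≤ y) (hne : y ≠ Real.exp L) :
    0 < entropyDivergence L y := by
  rcases hy.eq_or_lt with rfl | hy
  · simp [entropyDivergence, Real.exp_pos]
  · have ht : L - Real.log y ≠ 0 := fun h => hne (by
      rw [sub_eq_zero.mp h, Real.exp_log hy])
    have h := mul_lt_mul_of_pos_left (Real.add_one_lt_exp ht) hy
    rw [Real.exp_sub, Real.exp_log hy, mul_div_cancel₀ _ hy.ne'] at h
    rw [entropyDivergence]
    linarith

lemma entropyDivergence_nonneg {L y : ℝ} (hy : 0 ≤ y) : 0 ≤ entropyDivergence L y := by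
  by_cases h : y = Real.exp L
  · rw [h, entropyDivergence_exp]
  · exact (entropyDivergence_pos hy h).le

lemma entropyDivergence_eq_zero_iff {L y : ℝ} (hy : 0 ≤ y) :
    entropyDivergence L y = 0 ↔ y = Real.exp L :=
  ⟨fun h => by_contra fun hne => (entropyDivergence_pos hy hne).ne' h,
    fun h => h ▸ entropyDivergence_exp L⟩

/-- if `α` (with last component negative) satisfies the moment
equations `⟨m(ξ) 𝓔⟩ = ρ = (r, rU, rE)`, then the exponential tuple
`𝓔_m = exp(α ⬝ m_m)` minimizes the discrete entropy among all nonnegative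
measurable tuples `g` with `⟨m(ξ) g⟩ = ρ` and finite entropy, with equality
iff `g_m = 𝓔_m` a.e. for every `m`. -/
theorem stmt_2
    (D N : ℕ) (hD : 2 ≤ D) (hN : D ≤ N)
    (l : Fin N → EuclideanSpace ℝ (Fin D)) (hl : ∀ m, ‖l m‖ = 1)
    (hrank : Submodule.span ℝ (Set.range l) = ⊤)
    (r rE : ℝ) (rU : EuclideanSpace ℝ (Fin D))
    (α : ℝ × EuclideanSpace ℝ (Fin D) × ℝ) (hα : α.2.2 < 0)
    (hmom0 : mom0 (fun m => discEquil (l m) α) = r)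
    (hmom1 : mom1 l (fun m => discEquil (l m) α) = rU)
    (hmom2 : mom2 (fun m => discEquil (l m) α) = rE) :
    ∀ g : Fin N → ℝ → ℝ, (∀ m, Measurable (g m)) → (∀ m ξ, 0 ≤ g m ξ) →
      (∀ m, Integrable (g m)) →
      (∀ m, Integrable fun ξ => ξ * g m ξ) →
      (∀ m, Integrable fun ξ => ξ ^ 2 * g m ξ) →
      mom0 g = r → mom1 l g = rU → mom2 g = rE →
      (∀ m, Integrable fun ξ => g m ξ * Real.log (g m ξ) - g m ξ) →
      Hent (fun m => discEquil (l m) α) ≤ Hent g ∧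
        (Hent g = Hent (fun m => discEquil (l m) α) ↔
          ∀ m, g m =ᵐ[volume] discEquil (l m) α) := by
  intro g _ hnn hg hg1 hg2 hg0r hg1r hg2r hent
  have hE : ∀ m, Integrable (discEquil (l m) α) := fun m => integrable_exp_quadratic hα _ _
  have hE2 : ∀ m, Integrable fun ξ => ξ ^ 2 * discEquil (l m) α ξ :=
    fun m => integrable_sq_mul_exp_quadratic hα _ _
  have hE1 : ∀ m, Integrable fun ξ => ξ * discEquil (l m) α ξ :=
    fun m => integrable_id_mul_of_integrable_sq_mul (hE m) (hE2 m)
  have hLg := fun m => integrable_discExponent_mul (l m) α (hg m) (hg1 m) (hg2 m)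
  have hLE := fun m => integrable_discExponent_mul (l m) α (hE m) (hE1 m) (hE2 m)
  have hsum : ∑ m, ∫ ξ, discExponent (l m) α ξ * g m ξ
      = ∑ m, ∫ ξ, discExponent (l m) α ξ * discEquil (l m) α ξ := by
    rw [sum_integral_discExponent_mul l α hg hg1 hg2,
      sum_integral_discExponent_mul l α hE hE1 hE2, hg0r, hg1r, hg2r, hmom0, hmom1, hmom2]
  have hdint : ∀ m, Integrable fun ξ => entropyDivergence (discExponent (l m) α ξ) (g m ξ) :=
    fun m => ((hent m).sub (hLg m)).add (hE m)
  have hdnn : ∀ m ξ, 0 ≤ entropyDivergence (discExponent (l m) α ξ) (g m ξ) :=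
    fun m ξ => entropyDivergence_nonneg (hnn m ξ)
  have hd : ∀ m, ∫ ξ, entropyDivergence (discExponent (l m) α ξ) (g m ξ)
      = (∫ ξ, (g m ξ * Real.log (g m ξ) - g m ξ)) - (∫ ξ, discExponent (l m) α ξ * g m ξ)
        + ∫ ξ, discEquil (l m) α ξ := by
    intro m
    rw [← integral_sub (hent m) (hLg m)]
    exact integral_add ((hent m).sub (hLg m)) (hE m)
  have hHE : Hent (fun m => discEquil (l m) α)
      = ∑ m, ((∫ ξ, discExponent (l m) α ξ * discEquil (l m) α ξ)
        - ∫ ξ, discEquil (l m) α ξ) := by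
    refine Finset.sum_congr rfl fun m _ => ?_
    rw [← integral_sub (hLE m) (hE m)]
    refine integral_congr_ae (Filter.Eventually.of_forall fun ξ => ?_)
    simp only [discEquil_eq_exp, Real.log_exp]
    ring
  have hgap : Hent g - Hent (fun m => discEquil (l m) α)
      = ∑ m, ∫ ξ, entropyDivergence (discExponent (l m) α ξ) (g m ξ) := by
    rw [hHE, Finset.sum_congr rfl fun m _ => hd m, Finset.sum_add_distrib,
      Finset.sum_sub_distrib, Finset.sum_sub_distrib, hsum, Hent]
    ring
  have hgapnn : ∀ m ∈ Finset.univ,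
      0 ≤ ∫ ξ, entropyDivergence (discExponent (l m) α ξ) (g m ξ) :=
    fun m _ => integral_nonneg (hdnn m)
  refine ⟨sub_nonneg.mp (hgap ▸ Finset.sum_nonneg hgapnn), ?_⟩
  rw [← sub_eq_zero, hgap, Finset.sum_eq_zero_iff_of_nonneg hgapnn]
  simp only [Finset.mem_univ, true_imp_iff]
  refine forall_congr' fun m => ?_
  rw [integral_eq_zero_iff_of_nonneg (hdnn m) (hdint m)]
  exact Filter.eventually_congr (Filter.Eventually.of_forall fun ξ =>
    entropyDivergence_eq_zero_iff (hnn m ξ))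
end

section
/- For every ρ = (ρ, ρU, ρE) ∈ ℝ × ℝ^D × ℝ, the function J is strictly convex on the convex set 𝒟: for all distinct α, β ∈ 𝒟 and all t ∈ (0,1), J(tα + (1−t)β) < t J(α) + (1−t) J(β). -/
open scoped RealInnerProductSpace
open MeasureTheory

/-- The function `b² / (2 s)` is jointly convex in `(b, s)` for `s > 0`, with equality along the
segment only if its end points are proportional. -/
lemma sq_div_convex_defect (b d s u t : ℝ) (hs : 0 < s) (hu : 0 < u) (ht : 0 < t) (ht' : t < 1) :
    t * (b ^ 2 / (2 * s)) + (1 - t) * (d ^ 2 / (2 * u))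
      - (t * b + (1 - t) * d) ^ 2 / (2 * (t * s + (1 - t) * u))
      = t * (1 - t) * (b * u - d * s) ^ 2 / (2 * s * u * (t * s + (1 - t) * u)) := by
  have h1 : 0 < 1 - t := by linarith
  have hw : t * s + (1 - t) * u ≠ 0 := by positivity
  field_simp
  ring

/-- The logarithm of a summand of `Jfun`, up to the additive constant `log √(2π)`. -/
noncomputable def logWeight (a b s : ℝ) : ℝ := a + b ^ 2 / (2 * s) - Real.log s / 2

lemma sqrt_mul_exp_eq (a b s : ℝ) (hs : 0 < s) :
    Real.sqrt (2 * Real.pi / s) * Real.exp (a + b ^ 2 / (2 * s))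
      = Real.sqrt (2 * Real.pi) * Real.exp (logWeight a b s) := by
  have h : Real.exp (Real.log s / 2) = Real.sqrt s := by
    rw [Real.sqrt_eq_rpow, Real.rpow_def_of_pos hs]
    ring_nf
  rw [logWeight, Real.exp_sub, h, Real.sqrt_div (by positivity)]
  ring

lemma logWeight_convex_comb_le (a b s c d u t : ℝ) (hs : 0 < s) (hu : 0 < u) (ht : 0 < t)
    (ht' : t < 1) :
    logWeight (t * a + (1 - t) * c) (t * b + (1 - t) * d) (t * s + (1 - t) * u)
      ≤ t * logWeight a b s + (1 - t) * logWeight c d u := by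
  have h1 : 0 < 1 - t := by linarith
  have hq := sq_div_convex_defect b d s u t hs hu ht ht'
  have hq' : 0 ≤ t * (1 - t) * (b * u - d * s) ^ 2 / (2 * s * u * (t * s + (1 - t) * u)) := by
    positivity
  have hlog := strictConcaveOn_log_Ioi.concaveOn.2 (Set.mem_Ioi.2 hs) (Set.mem_Ioi.2 hu)
    ht.le h1.le (by ring)
  simp only [smul_eq_mul] at hlog
  unfold logWeight
  linarith

lemma logWeight_convex_comb_lt (a b s c d u t : ℝ) (hs : 0 < s) (hu : 0 < u) (ht : 0 < t)
    (ht' : t < 1) (hne : s ≠ u ∨ b ≠ d) :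
    logWeight (t * a + (1 - t) * c) (t * b + (1 - t) * d) (t * s + (1 - t) * u)
      < t * logWeight a b s + (1 - t) * logWeight c d u := by
  have h1 : 0 < 1 - t := by linarith
  have hq := sq_div_convex_defect b d s u t hs hu ht ht'
  by_cases hsu : s = u
  · have hbd : b - d ≠ 0 := sub_ne_zero.2 (hne.resolve_left (not_not.2 hsu))
    subst hsu
    have hq' : 0 < t * (1 - t) * (b * s - d * s) ^ 2 / (2 * s * s * (t * s + (1 - t) * s)) := by
      rw [← sub_mul]
      positivity
    have hw : t * s + (1 - t) * s = s := by ring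
    rw [hw] at hq hq' ⊢
    unfold logWeight
    linarith
  · have hq' : 0 ≤ t * (1 - t) * (b * u - d * s) ^ 2 / (2 * s * u * (t * s + (1 - t) * u)) := by
      positivity
    have hlog := strictConcaveOn_log_Ioi.2 (Set.mem_Ioi.2 hs) (Set.mem_Ioi.2 hu) hsu
      ht h1 (by ring)
    simp only [smul_eq_mul] at hlog
    unfold logWeight
    linarith

lemma exp_logWeight_convex_comb_le (a b s c d u t : ℝ) (hs : 0 < s) (hu : 0 < u) (ht : 0 < t)
    (ht' : t < 1) :
    Real.exp (logWeight (t * a + (1 - t) * c) (t * b + (1 - t) * d) (t * s + (1 - t) * u))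
      ≤ t * Real.exp (logWeight a b s) + (1 - t) * Real.exp (logWeight c d u) :=
  (Real.exp_le_exp.2 (logWeight_convex_comb_le a b s c d u t hs hu ht ht')).trans
    (convexOn_exp.2 (Set.mem_univ _) (Set.mem_univ _) ht.le (by linarith) (by ring))

lemma exp_logWeight_convex_comb_lt (a b s c d u t : ℝ) (hs : 0 < s) (hu : 0 < u) (ht : 0 < t)
    (ht' : t < 1) (hne : a ≠ c ∨ s ≠ u ∨ b ≠ d) :
    Real.exp (logWeight (t * a + (1 - t) * c) (t * b + (1 - t) * d) (t * s + (1 - t) * u))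
      < t * Real.exp (logWeight a b s) + (1 - t) * Real.exp (logWeight c d u) := by
  by_cases h : s ≠ u ∨ b ≠ d
  · exact (Real.exp_lt_exp.2 (logWeight_convex_comb_lt a b s c d u t hs hu ht ht' h)).trans_le
      (convexOn_exp.2 (Set.mem_univ _) (Set.mem_univ _) ht.le (by linarith) (by ring))
  · have hac : a ≠ c := hne.resolve_right h
    push Not at h
    obtain ⟨rfl, rfl⟩ := h
    have hφ : logWeight a b s ≠ logWeight c b s := by
      unfold logWeight
      intro h
      exact hac (by linarith)
    exact (Real.exp_le_exp.2 (logWeight_convex_comb_le a b s c b s t hs hs ht ht')).trans_lt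
      (strictConvexOn_exp.2 (Set.mem_univ _) (Set.mem_univ _) hφ ht (by linarith) (by ring))

lemma eq_zero_of_forall_inner_eq_zero_of_span_eq_top {ι E : Type*} [NormedAddCommGroup E]
    [InnerProductSpace ℝ E] (l : ι → E) (hspan : Submodule.span ℝ (Set.range l) = ⊤) (v : E)
    (h : ∀ m, ⟪v, l m⟫ = 0) : v = 0 := by
  have hv : v ∈ Submodule.span ℝ (Set.range l) := hspan ▸ Submodule.mem_top
  have key : ∀ w ∈ Submodule.span ℝ (Set.range l), ⟪v, w⟫ = 0 := by
    intro w hw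
    induction hw using Submodule.span_induction with
    | mem x hx => obtain ⟨m, rfl⟩ := hx; exact h m
    | zero => simp
    | add x y _ _ hx hy => rw [inner_add_right, hx, hy, add_zero]
    | smul c x _ hx => rw [inner_smul_right, hx, mul_zero]
  exact inner_self_eq_zero.1 (key v hv)

lemma Jfun_eq_sum_exp_logWeight {D N : ℕ} (l : Fin N → EuclideanSpace ℝ (Fin D))
    (r : ℝ) (rU : EuclideanSpace ℝ (Fin D)) (rE : ℝ)
    (α : ℝ × EuclideanSpace ℝ (Fin D) × ℝ) (hα : α.2.2 < 0) :
    Jfun l r rU rE α = Real.sqrt (2 * Real.pi) *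
      (∑ m, Real.exp (logWeight α.1 ⟪α.2.1, l m⟫ (-α.2.2)))
      - (r * α.1 + ⟪rU, α.2.1⟫ + rE * α.2.2) := by
  rw [Jfun, Finset.mul_sum]
  congr 1
  exact Finset.sum_congr rfl fun m _ => sqrt_mul_exp_eq _ _ _ (by linarith)

/-- for every `ρ = (r, rU, rE)`, the function `J` is strictly
convex on the convex set `𝒟 = {α : α_{D+1} < 0}`. -/
theorem stmt_5
    (D N : ℕ) (hD : 2 ≤ D) (hN : D ≤ N)
    (l : Fin N → EuclideanSpace ℝ (Fin D)) (hl : ∀ m, ‖l m‖ = 1)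
    (hrank : Submodule.span ℝ (Set.range l) = ⊤)
    (r rE : ℝ) (rU : EuclideanSpace ℝ (Fin D)) :
    ∀ α β : ℝ × EuclideanSpace ℝ (Fin D) × ℝ, α.2.2 < 0 → β.2.2 < 0 → α ≠ β →
      ∀ t : ℝ, 0 < t → t < 1 →
        Jfun l r rU rE (t • α + (1 - t) • β)
          < t * Jfun l r rU rE α + (1 - t) * Jfun l r rU rE β := by
  intro α β hα hβ hne t ht ht'
  have h1 : 0 < 1 - t := by linarith
  obtain ⟨a, x, c⟩ := α
  obtain ⟨a', x', c'⟩ := β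
  simp only at hα hβ
  have hγ : t * c + (1 - t) * c' < 0 := by nlinarith
  have hm : ∃ m, a ≠ a' ∨ -c ≠ -c' ∨ ⟪x, l m⟫ ≠ ⟪x', l m⟫ := by
    by_contra! h
    have h0 := h ⟨0, by omega⟩
    have hx : x - x' = 0 := eq_zero_of_forall_inner_eq_zero_of_span_eq_top l hrank _ fun m => by
      rw [inner_sub_left, (h m).2.2, sub_self]
    exact hne (by rw [h0.1, neg_injective h0.2.1, sub_eq_zero.1 hx])
  obtain ⟨m₀, hm₀⟩ := hm
  rw [Jfun_eq_sum_exp_logWeight _ _ _ _ _ (by simpa using hγ),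
    Jfun_eq_sum_exp_logWeight _ _ _ _ _ hα, Jfun_eq_sum_exp_logWeight _ _ _ _ _ hβ]
  simp only [Prod.smul_mk, Prod.mk_add_mk, smul_eq_mul, inner_add_left, inner_add_right,
    real_inner_smul_left, real_inner_smul_right]
  have hc : -(t * c + (1 - t) * c') = t * -c + (1 - t) * -c' := by ring
  rw [hc]
  have hsum := Finset.sum_lt_sum (s := Finset.univ)
    (fun m _ => exp_logWeight_convex_comb_le a ⟪x, l m⟫ (-c) a' ⟪x', l m⟫ (-c') t
      (by linarith) (by linarith) ht ht')
    ⟨m₀, Finset.mem_univ _, exp_logWeight_convex_comb_lt a ⟪x, l m₀⟫ (-c) a' ⟪x', l m₀⟫ (-c') t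
      (by linarith) (by linarith) ht ht' hm₀⟩
  rw [Finset.sum_add_distrib, ← Finset.mul_sum, ← Finset.mul_sum] at hsum
  have hpi : 0 < Real.sqrt (2 * Real.pi) := by positivity
  have := mul_lt_mul_of_pos_left hsum hpi
  linarith
end

section
/- Let f = (f_1,…,f_N) be an N-tuple of nonnegative measurable functions on ℝ such that all components of ρ := ⟨m(ξ) f⟩ = (ρ, ρU, ρE) are finite and ρ ≠ 0 as a vector. Then ρ > 0, E > 0, and, in case U := |U| ≠ 0, E > (1/2) U² s_min(U/|U|)². -/
open scoped RealInnerProductSpace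
open MeasureTheory

/-- The second moment about `c` of an integrable function, expanded. -/
theorem integral_sub_sq_mul {g : ℝ → ℝ} (h0 : Integrable g)
    (h1 : Integrable fun ξ => ξ * g ξ) (h2 : Integrable fun ξ => ξ ^ 2 * g ξ) (c : ℝ) :
    Integrable (fun ξ => (ξ - c) ^ 2 * g ξ) ∧
      ∫ ξ, (ξ - c) ^ 2 * g ξ
        = (∫ ξ, ξ ^ 2 * g ξ) - 2 * c * (∫ ξ, ξ * g ξ) + c ^ 2 * ∫ ξ, g ξ := by
  have h : (fun ξ => (ξ - c) ^ 2 * g ξ)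
      = fun ξ => ξ ^ 2 * g ξ - 2 * c * (ξ * g ξ) + c ^ 2 * g ξ := by
    ext ξ; ring
  have h21 : Integrable fun ξ => ξ ^ 2 * g ξ - 2 * c * (ξ * g ξ) := h2.sub (h1.const_mul _)
  rw [h]
  refine ⟨h21.add (h0.const_mul _), ?_⟩
  rw [integral_add h21 (h0.const_mul _), integral_sub h2 (h1.const_mul _),
    integral_const_mul, integral_const_mul]

/-- A nonnegative density of positive mass has positive second moment about every point. -/
theorem integral_sub_sq_mul_pos {g : ℝ → ℝ} (hg : ∀ ξ, 0 ≤ g ξ) {c : ℝ}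
    (hint : Integrable fun ξ => (ξ - c) ^ 2 * g ξ) (hpos : 0 < ∫ ξ, g ξ) :
    0 < ∫ ξ, (ξ - c) ^ 2 * g ξ := by
  have hnonneg : 0 ≤ fun ξ => (ξ - c) ^ 2 * g ξ := fun ξ => mul_nonneg (sq_nonneg _) (hg ξ)
  refine (integral_nonneg hnonneg).lt_of_ne' fun h => hpos.ne' ?_
  refine integral_eq_zero_of_ae ?_
  filter_upwards [(integral_eq_zero_iff_of_nonneg hnonneg hint).1 h,
    Measure.ae_ne volume c] with ξ h1 h2
  simpa [sub_eq_zero, h2] using h1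

theorem smin_nonneg {D N : ℕ} (l : Fin N → EuclideanSpace ℝ (Fin D))
    (e : EuclideanSpace ℝ (Fin D)) : 0 ≤ smin l e := by
  refine Real.sInf_nonneg ?_
  rintro _ ⟨a, -, rfl⟩
  positivity

theorem smin_sum_smul_le {D N : ℕ} (l : Fin N → EuclideanSpace ℝ (Fin D)) (a : Fin N → ℝ) :
    smin l (∑ m, a m • l m) ≤ ∑ m, |a m| := by
  refine csInf_le ⟨0, ?_⟩ ⟨a, rfl, rfl⟩
  rintro _ ⟨b, -, rfl⟩
  positivity

/-- The scaled quantity `‖v‖ s_min(v/‖v‖)` is bounded by the cost of any representation of `v`. -/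
theorem norm_mul_smin_le {D N : ℕ} (l : Fin N → EuclideanSpace ℝ (Fin D))
    {v : EuclideanSpace ℝ (Fin D)} (hv : v ≠ 0) {a : Fin N → ℝ} (ha : v = ∑ m, a m • l m) :
    ‖v‖ * smin l (‖v‖⁻¹ • v) ≤ ∑ m, |a m| := by
  have hv' : 0 < ‖v‖ := norm_pos_iff.2 hv
  have h := smin_sum_smul_le l fun m => ‖v‖⁻¹ * a m
  have he : ∑ m, (‖v‖⁻¹ * a m) • l m = ‖v‖⁻¹ • v := by
    conv_rhs => rw [ha]
    rw [Finset.smul_sum, ← ha]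
    simp only [mul_smul]
  rw [he] at h
  simp only [abs_mul, abs_inv, abs_norm, ← Finset.mul_sum] at h
  rwa [le_inv_mul_iff₀ hv'] at h

theorem mom2_eq {N : ℕ} (f : Fin N → ℝ → ℝ) :
    mom2 f = 1 / 2 * ∑ m, ∫ ξ, ξ ^ 2 * f m ξ := by
  rw [mom2, Finset.mul_sum]
  refine Finset.sum_congr rfl fun m _ => ?_
  rw [← integral_const_mul]
  congr 1; ext ξ; ring

/-- if `f` is a nonnegative measurable `N`-tuple with finite
moments `ρ = (ρ, ρU, ρE) ≠ 0`, then `ρ > 0`, `E := ρE/ρ > 0` and, whenever the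
bulk velocity `U := ρU/ρ` is nonzero, `E > ½|U|² s_min(U/|U|)²`. -/
theorem stmt_6
    (D N : ℕ) (hD : 2 ≤ D) (hN : D ≤ N)
    (l : Fin N → EuclideanSpace ℝ (Fin D)) (hl : ∀ m, ‖l m‖ = 1)
    (hrank : Submodule.span ℝ (Set.range l) = ⊤)
    (f : Fin N → ℝ → ℝ)
    (hfmeas : ∀ m, Measurable (f m)) (hfpos : ∀ m ξ, 0 ≤ f m ξ)
    (hfint0 : ∀ m, Integrable (f m))
    (hfint1 : ∀ m, Integrable fun ξ => ξ * f m ξ)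
    (hfint2 : ∀ m, Integrable fun ξ => ξ ^ 2 * f m ξ)
    (hρ : ¬(mom0 f = 0 ∧ mom1 l f = 0 ∧ mom2 f = 0)) :
    0 < mom0 f ∧ 0 < mom2 f / mom0 f ∧
      ((mom0 f)⁻¹ • mom1 l f ≠ 0 →
        1 / 2 * ‖(mom0 f)⁻¹ • mom1 l f‖ ^ 2 *
            smin l (‖(mom0 f)⁻¹ • mom1 l f‖⁻¹ • ((mom0 f)⁻¹ • mom1 l f)) ^ 2
          < mom2 f / mom0 f) := by
  have hA (m : Fin N) : 0 ≤ ∫ ξ, f m ξ := integral_nonneg (hfpos m)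
  have hr0 : 0 ≤ mom0 f := Finset.sum_nonneg fun m _ => hA m
  have hr : 0 < mom0 f := by
    refine hr0.lt_of_ne' fun h => hρ ?_
    have hz (m : Fin N) : f m =ᵐ[volume] 0 :=
      (integral_eq_zero_iff_of_nonneg (hfpos m) (hfint0 m)).1
        ((Finset.sum_eq_zero_iff_of_nonneg fun m _ => hA m).1 h m (Finset.mem_univ m))
    refine ⟨h, Finset.sum_eq_zero fun m _ => ?_, Finset.sum_eq_zero fun m _ => ?_⟩
    · rw [integral_eq_zero_of_ae, zero_smul]
      filter_upwards [hz m] with ξ hξ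
      simp [hξ]
    · refine integral_eq_zero_of_ae ?_
      filter_upwards [hz m] with ξ hξ
      simp [hξ]
  have hvar (c : Fin N → ℝ) : 0 < ∑ m, ∫ ξ, (ξ - c m) ^ 2 * f m ξ := by
    obtain ⟨k, -, hk⟩ : ∃ k ∈ Finset.univ, 0 < ∫ ξ, f k ξ :=
      (Finset.sum_pos_iff_of_nonneg fun m _ => hA m).1 hr
    refine Finset.sum_pos' (fun m _ => integral_nonneg fun ξ =>
      mul_nonneg (sq_nonneg _) (hfpos m ξ)) ⟨k, Finset.mem_univ k, ?_⟩
    exact integral_sub_sq_mul_pos (hfpos k)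
      (integral_sub_sq_mul (hfint0 k) (hfint1 k) (hfint2 k) _).1 hk
  set S := ∑ m, |∫ ξ, ξ * f m ξ| with hS
  have hE : (S / mom0 f) ^ 2 < 2 * (mom2 f / mom0 f) := by
    have h := hvar fun m => S / mom0 f * SignType.sign (∫ ξ, ξ * f m ξ)
    have hle (m : Fin N) :
        ∫ ξ, (ξ - S / mom0 f * SignType.sign (∫ ξ, ξ * f m ξ)) ^ 2 * f m ξ
          ≤ (∫ ξ, ξ ^ 2 * f m ξ) - 2 * (S / mom0 f) * |∫ ξ, ξ * f m ξ|
            + (S / mom0 f) ^ 2 * ∫ ξ, f m ξ := by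
      rw [(integral_sub_sq_mul (hfint0 m) (hfint1 m) (hfint2 m) _).2, mul_pow,
        ← sign_mul_self (∫ ξ, ξ * f m ξ)]
      have hs : ((SignType.sign (∫ ξ, ξ * f m ξ) : SignType) : ℝ) ^ 2 ≤ 1 := by
        cases SignType.sign (∫ ξ, ξ * f m ξ) <;> simp
      have := mul_le_mul_of_nonneg_right
        (mul_le_mul_of_nonneg_left hs (sq_nonneg (S / mom0 f))) (hA m)
      linarith
    have h' := h.trans_le (Finset.sum_le_sum fun m _ => hle m)
    rw [Finset.sum_add_distrib, Finset.sum_sub_distrib, ← Finset.mul_sum, ← Finset.mul_sum,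
      ← hS] at h'
    change 0 < _ - _ + (S / mom0 f) ^ 2 * mom0 f at h'
    have hSr : S = S / mom0 f * mom0 f := (div_mul_cancel₀ S hr.ne').symm
    have h2 := mom2_eq f
    rw [← mul_div_assoc, lt_div_iff₀ hr]
    generalize S / mom0 f = q at *
    rw [hSr] at h'
    linarith
  refine ⟨hr, by nlinarith [sq_nonneg (S / mom0 f)], fun hU => ?_⟩
  have hle := norm_mul_smin_le l hU (a := fun m => (mom0 f)⁻¹ * ∫ ξ, ξ * f m ξ)
    (by simp only [mom1, Finset.smul_sum, mul_smul])
  simp only [abs_mul, abs_inv, abs_of_pos hr, ← Finset.mul_sum] at hle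
  rw [← hS, inv_mul_eq_div] at hle
  have hsq := pow_le_pow_left₀ (mul_nonneg (norm_nonneg _) (smin_nonneg l _)) hle 2
  rw [mul_pow] at hsq
  linarith
end

section
/- Fix ρ = (ρ, ρU, ρE) ∈ ℝ × ℝ^D × ℝ with ρ > 0 and E finite, and set U = |U|. If a sequence (α^{(p)})_{p≥1} ⊂ 𝒟 satisfies α_{D+1}^{(p)} → 0 as p → ∞, then there is a subsequence (α^{(p_k)})_{k≥1} such that J(α^{(p_k)}) → +∞. -/
open scoped RealInnerProductSpace
open MeasureTheory

/-- Young's inequality combined with the tangent-line bound for `exp`: a lower bound, uniform in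
`a` and `s`, for one exponential term minus affine terms in `a` and `s`. -/
lemma sqrt_mul_exp_sub_ge {r t : ℝ} (hr : 0 < r) (ht : 0 < t) (a s K : ℝ) :
    r - r * Real.log r + r / 2 * Real.log (2 * Real.pi / t) - K ^ 2 * t / (2 * r) ≤
      Real.sqrt (2 * Real.pi / t) * Real.exp (a + s ^ 2 / (2 * t)) - r * a - K * s := by
  have hy : 0 < 2 * Real.pi / t := by positivity
  set L := Real.log (2 * Real.pi / t) with hL
  have hsqrt : Real.sqrt (2 * Real.pi / t) = Real.exp (L / 2) := by
    rw [hL, ← Real.log_sqrt hy.le, Real.exp_log (Real.sqrt_pos.2 hy)]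
  set β := L / 2 + (a + s ^ 2 / (2 * t)) with hβ
  have hexp : r * (β - Real.log r + 1) ≤ Real.exp β := by
    calc r * (β - Real.log r + 1) ≤ r * Real.exp (β - Real.log r) :=
          mul_le_mul_of_nonneg_left (Real.add_one_le_exp _) hr.le
      _ = Real.exp β := by
          rw [Real.exp_sub, Real.exp_log hr]
          field_simp
  have hyoung : r * (s ^ 2 / (2 * t)) - K * s + K ^ 2 * t / (2 * r) =
      (r * s - K * t) ^ 2 / (2 * r * t) := by
    field_simp
    ring
  have hsq : 0 ≤ (r * s - K * t) ^ 2 / (2 * r * t) := by positivity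
  rw [hsqrt, ← Real.exp_add, ← hβ]
  rw [hβ] at hexp
  linarith

/-- `J` is bounded below by a function of `α_{D+1}` alone. -/
lemma exists_le_Jfun {D N : ℕ} [Nonempty (Fin N)] (l : Fin N → EuclideanSpace ℝ (Fin D))
    (hrank : Submodule.span ℝ (Set.range l) = ⊤) (r rE : ℝ) (rU : EuclideanSpace ℝ (Fin D))
    (hr : 0 < r) :
    ∃ K : ℝ, ∀ α : ℝ × EuclideanSpace ℝ (Fin D) × ℝ, α.2.2 < 0 →
      r - r * Real.log r + r / 2 * Real.log (2 * Real.pi / (-α.2.2))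
        - K ^ 2 * (-α.2.2) / (2 * r) - rE * α.2.2 ≤ Jfun l r rU rE α := by
  obtain ⟨a, ha⟩ := (Submodule.mem_span_range_iff_exists_fun ℝ).1
    (hrank ▸ Submodule.mem_top : rU ∈ Submodule.span ℝ (Set.range l))
  refine ⟨∑ m, |a m|, fun α hα => ?_⟩
  obtain ⟨m₀, hm₀⟩ := Finite.exists_max fun m => |⟪α.2.1, l m⟫|
  have hU : ⟪rU, α.2.1⟫ ≤ (∑ m, |a m|) * |⟪α.2.1, l m₀⟫| := by
    rw [← ha, sum_inner, Finset.sum_mul]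
    refine Finset.sum_le_sum fun m _ => ?_
    rw [real_inner_smul_left, real_inner_comm]
    calc a m * ⟪α.2.1, l m⟫ ≤ |a m| * |⟪α.2.1, l m⟫| := by
          rw [← abs_mul]
          exact le_abs_self _
      _ ≤ _ := mul_le_mul_of_nonneg_left (hm₀ m) (abs_nonneg _)
  have hsum := Finset.single_le_sum
    (f := fun m => Real.sqrt (2 * Real.pi / (-α.2.2)) *
      Real.exp (α.1 + ⟪α.2.1, l m⟫ ^ 2 / (2 * (-α.2.2))))
    (fun m _ => by positivity) (Finset.mem_univ m₀)
  have hbound := sqrt_mul_exp_sub_ge hr (neg_pos.2 hα) α.1 |⟪α.2.1, l m₀⟫| (∑ m, |a m|)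
  rw [sq_abs] at hbound
  simp only [Jfun]
  linarith

/-- fix `ρ = (r, rU, rE)` with `r > 0`.  If a sequence
`(α⁽ᵖ⁾) ⊂ 𝒟` satisfies `α_{D+1}⁽ᵖ⁾ → 0`, then some subsequence satisfies
`J(α⁽ᵖᵏ⁾) → +∞`. -/
theorem stmt_8
    (D N : ℕ) (hD : 2 ≤ D) (hN : D ≤ N)
    (l : Fin N → EuclideanSpace ℝ (Fin D)) (hl : ∀ m, ‖l m‖ = 1)
    (hrank : Submodule.span ℝ (Set.range l) = ⊤)
    (r rE : ℝ) (rU : EuclideanSpace ℝ (Fin D)) (hr : 0 < r)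
    (α : ℕ → ℝ × EuclideanSpace ℝ (Fin D) × ℝ)
    (hmem : ∀ p, (α p).2.2 < 0)
    (hlim : Filter.Tendsto (fun p => (α p).2.2) Filter.atTop (nhds 0)) :
    ∃ φ : ℕ → ℕ, StrictMono φ ∧
      Filter.Tendsto (fun k => Jfun l r rU rE (α (φ k))) Filter.atTop
        Filter.atTop := by
  have : Nonempty (Fin N) := ⟨⟨0, by omega⟩⟩
  obtain ⟨K, hK⟩ := exists_le_Jfun l hrank r rE rU hr
  refine ⟨id, strictMono_id, Filter.tendsto_atTop_mono (fun p => hK (α p) (hmem p)) ?_⟩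
  have hpos : Filter.Tendsto (fun p => -(α p).2.2) Filter.atTop (nhdsWithin 0 (Set.Ioi 0)) :=
    tendsto_nhdsWithin_iff.2 ⟨by simpa using hlim.neg, .of_forall fun p => neg_pos.2 (hmem p)⟩
  have hlog : Filter.Tendsto (fun p => Real.log (2 * Real.pi / (-(α p).2.2)))
      Filter.atTop Filter.atTop := by
    simp only [div_eq_mul_inv]
    exact Real.tendsto_log_atTop.comp
      ((tendsto_inv_nhdsGT_zero.comp hpos).const_mul_atTop Real.two_pi_pos)
  have hmain := Filter.tendsto_atTop_add_const_left _ (r - r * Real.log r)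
    (hlog.const_mul_atTop (half_pos hr))
  have hquad := ((hlim.neg.const_mul (K ^ 2)).div_const (2 * r)).neg
  simpa only [sub_eq_add_neg] using (hmain.atTop_add hquad).atTop_add (hlim.const_mul rE).neg
end

section
/- Fix ρ = (ρ, ρU, ρE) ∈ ℝ × ℝ^D × ℝ with ρ > 0 and set U = |U|. There exists a constant C > 0, depending only on the directions l_1,…,l_N, such that for every α = (α_0, α̂, α_{D+1}) ∈ 𝒟 one has J(α) ≥ (C/√|α_{D+1}|) · exp( α_0 + C |α̂|²/|α_{D+1}| ) − ρ (α_0 + U |α̂|) − ρ E α_{D+1}. -/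
open scoped RealInnerProductSpace
open MeasureTheory

/-- If the vectors `l m` span, the largest of the `|⟪v, l m⟫|` controls `‖v‖`. -/
theorem exists_sq_norm_le_sq_inner_of_span_eq_top {ι V : Type*} [Fintype ι] [Nonempty ι]
    [NormedAddCommGroup V] [InnerProductSpace ℝ V] [FiniteDimensional ℝ V]
    (l : ι → V) (h : Submodule.span ℝ (Set.range l) = ⊤) :
    ∃ c : ℝ, 0 < c ∧ ∀ v : V, ∃ m, c * ‖v‖ ^ 2 ≤ ⟪v, l m⟫ ^ 2 := by
  let f : V →ₗ[ℝ] (ι → ℝ) := LinearMap.pi fun m => innerₗ V (l m)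
  have hf (v : V) (m : ι) : f v m = ⟪v, l m⟫ := by
    simp [f, real_inner_comm]
  have hker : LinearMap.ker f = ⊥ := by
    refine (Submodule.eq_bot_iff _).2 fun v hv => ?_
    have hv0 (m : ι) : ⟪v, l m⟫ = 0 := by
      rw [← hf, LinearMap.mem_ker.1 hv, Pi.zero_apply]
    have hle : Submodule.span ℝ (Set.range l) ≤ LinearMap.ker (innerₗ V v) := by
      rw [Submodule.span_le]
      rintro _ ⟨m, rfl⟩
      simpa using hv0 m
    have hmem : v ∈ LinearMap.ker (innerₗ V v) := hle (h ▸ Submodule.mem_top)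
    simpa using hmem
  obtain ⟨K, hK, hlip⟩ := f.exists_antilipschitzWith hker
  have hK' : (0 : ℝ) < K := hK
  refine ⟨((K : ℝ) ^ 2)⁻¹, by positivity, fun v => ?_⟩
  obtain ⟨m, hm⟩ := Finite.exists_max fun m => ‖f v m‖
  refine ⟨m, ?_⟩
  have hsup : ‖f v‖ ≤ ‖f v m‖ := (pi_norm_le_iff_of_nonneg (norm_nonneg _)).2 hm
  have hv : ‖v‖ ≤ K * ‖f v m‖ := by
    have h1 := hlip.le_mul_dist v 0
    simp only [map_zero, dist_zero_right] at h1
    exact h1.trans (by gcongr)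
  rw [← hf v m, ← sq_abs (f v m), ← Real.norm_eq_abs, inv_mul_le_iff₀ (by positivity), ← mul_pow]
  gcongr

/-- fix `ρ = (r, r•U, r*E)` with `r > 0`.  There is `C > 0`
(depending only on the directions) such that for every `α ∈ 𝒟`,
`J(α) ≥ (C/√|α_{D+1}|) exp(α₀ + C|α̂|²/|α_{D+1}|) − r(α₀ + |U||α̂|) − rE α_{D+1}`. -/
theorem stmt_9
    (D N : ℕ) (hD : 2 ≤ D) (hN : D ≤ N)
    (l : Fin N → EuclideanSpace ℝ (Fin D)) (hl : ∀ m, ‖l m‖ = 1)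
    (hrank : Submodule.span ℝ (Set.range l) = ⊤)
    (r E : ℝ) (U : EuclideanSpace ℝ (Fin D)) (hr : 0 < r) :
    ∃ C : ℝ, 0 < C ∧
      ∀ α : ℝ × EuclideanSpace ℝ (Fin D) × ℝ, α.2.2 < 0 →
        C / Real.sqrt |α.2.2| * Real.exp (α.1 + C * ‖α.2.1‖ ^ 2 / |α.2.2|)
            - r * (α.1 + ‖U‖ * ‖α.2.1‖) - r * E * α.2.2
          ≤ Jfun l r (r • U) (r * E) α := by
  have : Nonempty (Fin N) := ⟨⟨0, by omega⟩⟩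
  obtain ⟨c, hc, hcoer⟩ := exists_sq_norm_le_sq_inner_of_span_eq_top l hrank
  refine ⟨min 1 (c / 2), by positivity, ?_⟩
  rintro ⟨a, v, t⟩ (ht : t < 0)
  obtain ⟨s, hs, rfl⟩ : ∃ s : ℝ, 0 < s ∧ t = -s := ⟨-t, by linarith, by ring⟩
  obtain ⟨m, hm⟩ := hcoer v
  simp only [Jfun, abs_neg, neg_neg, abs_of_pos hs]
  have hsqrt : min 1 (c / 2) / √s ≤ √(2 * Real.pi / s) := by
    rw [Real.sqrt_div (by positivity)]
    gcongr
    exact (min_le_left _ _).trans (Real.one_le_sqrt.2 (by linarith [Real.pi_gt_three]))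
  have hexp : min 1 (c / 2) * ‖v‖ ^ 2 / s ≤ ⟪v, l m⟫ ^ 2 / (2 * s) := by
    rw [← div_div]
    gcongr
    have := mul_le_mul_of_nonneg_right (min_le_right 1 (c / 2)) (sq_nonneg ‖v‖)
    linarith
  have hterm : min 1 (c / 2) / √s * Real.exp (a + min 1 (c / 2) * ‖v‖ ^ 2 / s) ≤
      √(2 * Real.pi / s) * Real.exp (a + ⟪v, l m⟫ ^ 2 / (2 * s)) := by
    gcongr
  have hsum := Finset.single_le_sum
    (f := fun m => √(2 * Real.pi / s) * Real.exp (a + ⟪v, l m⟫ ^ 2 / (2 * s)))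
    (fun _ _ => by positivity) (Finset.mem_univ m)
  have hU : ⟪r • U, v⟫ ≤ r * (‖U‖ * ‖v‖) := by
    rw [real_inner_smul_left]
    gcongr
    exact real_inner_le_norm U v
  linarith
end

section
/- Suppose ρ = (ρ, ρU, ρE) ∈ ℝ × ℝ^D × ℝ satisfies ρ > 0, E > 0, and, in case U := |U| ≠ 0, E > (1/2) U² s_min(U/|U|)². Let 𝕊_-^{D+1} = { w = (w_0, ŵ, w_{D+1}) ∈ ℝ^{D+2} : |w| = 1, w_{D+1} < 0 }. Then for every w ∈ 𝕊_-^{D+1} there exists an open neighborhood Ω(w) of w in 𝕊_-^{D+1} such that J(t w') → +∞ as t → +∞ uniformly on Ω(w), i.e. lim_{t→+∞} inf_{w' ∈ Ω(w)} J(t w') = +∞. -/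
open scoped RealInnerProductSpace
open MeasureTheory

/-- Under the realizability condition, `U` is a combination of the `l m` whose `ℓ¹` norm `S`
satisfies `S² < 2E`. -/
lemma exists_coeff_sq_sum_abs_lt {D N : ℕ} (l : Fin N → EuclideanSpace ℝ (Fin D))
    (hrank : Submodule.span ℝ (Set.range l) = ⊤) (E : ℝ) (U : EuclideanSpace ℝ (Fin D))
    (hE : 0 < E) (hU : U ≠ 0 → 1 / 2 * ‖U‖ ^ 2 * smin l (‖U‖⁻¹ • U) ^ 2 < E) :
    ∃ a : Fin N → ℝ, ∑ m, a m • l m = U ∧ (∑ m, |a m|) ^ 2 < 2 * E := by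
  rcases eq_or_ne U 0 with rfl | hne
  · exact ⟨0, by simp, by simpa using hE⟩
  have hn : 0 < ‖U‖ := norm_pos_iff.mpr hne
  have h := hU hne
  have hlt : smin l (‖U‖⁻¹ • U) < √(2 * E) / ‖U‖ := by
    rw [lt_div_iff₀ hn]
    apply Real.lt_sqrt_of_sq_lt
    nlinarith
  obtain ⟨b, hb⟩ : ∃ b : Fin N → ℝ, ∑ m, b m • l m = ‖U‖⁻¹ • U :=
    (Submodule.mem_span_range_iff_exists_fun ℝ).mp (hrank ▸ Submodule.mem_top)
  obtain ⟨s, ⟨a, ha, rfl⟩, hs⟩ := exists_lt_of_csInf_lt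
    (s := {s : ℝ | ∃ a : Fin N → ℝ, (∑ m, a m • l m) = ‖U‖⁻¹ • U ∧ s = ∑ m, |a m|})
    ⟨_, b, hb, rfl⟩ hlt
  refine ⟨fun m => ‖U‖ * a m, ?_, ?_⟩
  · simp_rw [mul_smul]
    rw [← Finset.smul_sum, ha, smul_inv_smul₀ hn.ne']
  · simp_rw [abs_mul, abs_norm]
    rw [← Finset.mul_sum, mul_comm]
    rw [lt_div_iff₀ hn] at hs
    have h0 : 0 ≤ (∑ m, |a m|) * ‖U‖ := by positivity
    exact (Real.lt_sqrt h0).mp hs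

/-- If every `x m ^ 2 / (2 * c)` is at most `B`, then by Young's inequality `∑ a m * x m` is at
most `B + S² c / 2`, where `S` is the `ℓ¹` norm of `a`. -/
lemma sum_mul_le_add_sq_sum_abs {ι : Type*} [Fintype ι] (a x : ι → ℝ) {B c : ℝ}
    (hc : 0 < c) (hB : 0 ≤ B) (hx : ∀ m, x m ^ 2 / (2 * c) ≤ B) :
    ∑ m, a m * x m ≤ B + (∑ m, |a m|) ^ 2 * c / 2 := by
  have hx' (m : ι) : |x m| ≤ √(2 * c * B) := by
    apply Real.abs_le_sqrt
    have := hx m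
    rw [div_le_iff₀ (by positivity)] at this
    linarith
  have h1 : ∑ m, a m * x m ≤ (∑ m, |a m|) * √(2 * c * B) := by
    rw [Finset.sum_mul]
    refine Finset.sum_le_sum fun m _ => (le_abs_self _).trans ?_
    rw [abs_mul]
    exact mul_le_mul_of_nonneg_left (hx' m) (abs_nonneg _)
  have h2 : √(2 * c * B) ^ 2 = 2 * c * B := Real.sq_sqrt (by positivity)
  have h3 := sq_nonneg (√(2 * c * B) - c * ∑ m, |a m|)
  refine h1.trans (le_of_mul_le_mul_left ?_ hc)
  nlinarith

/-- If every exponent is below `δ`, the linear part of `Jfun` is bounded above. -/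
lemma add_inner_sub_le {D N : ℕ} {l : Fin N → EuclideanSpace ℝ (Fin D)} (hN : 0 < N)
    {a : Fin N → ℝ} {U : EuclideanSpace ℝ (Fin D)} (ha : ∑ m, a m • l m = U)
    (v : EuclideanSpace ℝ (Fin D)) {x₀ c δ : ℝ} (E : ℝ) (hc : 0 < c)
    (h : ∀ m, x₀ + ⟪v, l m⟫ ^ 2 / (2 * c) < δ) :
    x₀ + ⟪U, v⟫ - E * c ≤ δ - (E - (∑ m, |a m|) ^ 2 / 2) * c := by
  have hB (m : Fin N) : ⟪v, l m⟫ ^ 2 / (2 * c) ≤ δ - x₀ := by linarith [h m]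
  have hB0 : 0 ≤ δ - x₀ := le_trans (by positivity) (hB ⟨0, hN⟩)
  have hyoung := sum_mul_le_add_sq_sum_abs a (fun m => ⟪v, l m⟫) hc hB0 hB
  have hUv : ⟪U, v⟫ = ∑ m, a m * ⟪v, l m⟫ := by
    rw [← ha, sum_inner]
    exact Finset.sum_congr rfl fun m _ => by rw [real_inner_smul_left, real_inner_comm]
  rw [hUv]
  linarith

/-- The value of `Jfun` on the ray through `(x₀, v, -c)`. -/
lemma Jfun_smul {D N : ℕ} (l : Fin N → EuclideanSpace ℝ (Fin D)) (r E : ℝ)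
    (U v : EuclideanSpace ℝ (Fin D)) (x₀ c : ℝ) {t : ℝ} (ht : 0 < t) (hc : 0 < c) :
    Jfun l r (r • U) (r * E) (t • (x₀, v, -c)) =
      (∑ m, √(2 * Real.pi / (t * c)) * Real.exp (t * (x₀ + ⟪v, l m⟫ ^ 2 / (2 * c))))
        - t * (r * (x₀ + ⟪U, v⟫ - E * c)) := by
  have hterm (m : Fin N) :
      t * x₀ + ⟪t • v, l m⟫ ^ 2 / (2 * (t * c)) = t * (x₀ + ⟪v, l m⟫ ^ 2 / (2 * c)) := by
    rw [real_inner_smul_left]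
    field_simp
  simp only [Jfun, Prod.smul_mk, smul_eq_mul, mul_neg, neg_neg, hterm]
  rw [real_inner_smul_left, real_inner_smul_right]
  ring

/-- The single exponential term dominates the linear part as `t → ∞`. -/
lemma tendsto_exp_mul_div_sub_mul {δ : ℝ} (hδ : 0 < δ) (K : ℝ) :
    Filter.Tendsto (fun t : ℝ => Real.exp (δ * t) / t - t * K) Filter.atTop Filter.atTop := by
  have h := tendsto_exp_mul_div_rpow_atTop 2 δ hδ
  have h' := Filter.tendsto_id.atTop_mul_atTop₀ (Filter.tendsto_atTop_add_const_right _ (-K) h)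
  refine h'.congr' ?_
  filter_upwards [Filter.eventually_gt_atTop 0] with t ht
  simp only [id, Real.rpow_two]
  field_simp
  ring

/-- under the realizability conditions on `ρ = (r, r•U, r*E)`
(`r > 0`, `E > 0`, and `E > ½|U|² s_min(U/|U|)²` when `U ≠ 0`), every point `w`
of the half unit sphere `𝕊₋ = {|w| = 1, w_{D+1} < 0}` has a relatively open
neighborhood `Ω(w)` in `𝕊₋` on which `J(t w') → +∞` uniformly as `t → +∞`. -/
theorem stmt_10
    (D N : ℕ) (hD : 2 ≤ D) (hN : D ≤ N)
    (l : Fin N → EuclideanSpace ℝ (Fin D)) (hl : ∀ m, ‖l m‖ = 1)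
    (hrank : Submodule.span ℝ (Set.range l) = ⊤)
    (r E : ℝ) (U : EuclideanSpace ℝ (Fin D))
    (hr : 0 < r) (hE : 0 < E)
    (hU : U ≠ 0 → 1 / 2 * ‖U‖ ^ 2 * smin l (‖U‖⁻¹ • U) ^ 2 < E) :
    ∀ w : ℝ × EuclideanSpace ℝ (Fin D) × ℝ,
      w.1 ^ 2 + ‖w.2.1‖ ^ 2 + w.2.2 ^ 2 = 1 → w.2.2 < 0 →
      ∃ Ω : Set (ℝ × EuclideanSpace ℝ (Fin D) × ℝ), w ∈ Ω ∧
        (∃ V : Set (ℝ × EuclideanSpace ℝ (Fin D) × ℝ), IsOpen V ∧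
          Ω = V ∩ {w' : ℝ × EuclideanSpace ℝ (Fin D) × ℝ |
            w'.1 ^ 2 + ‖w'.2.1‖ ^ 2 + w'.2.2 ^ 2 = 1 ∧ w'.2.2 < 0}) ∧
        ∀ M : ℝ, ∃ T : ℝ, ∀ t : ℝ, T < t → ∀ w' ∈ Ω,
          M < Jfun l r (r • U) (r * E) (t • w') := by
  intro w hsph hw
  obtain ⟨a, ha, hS⟩ := exists_coeff_sq_sum_abs_lt l hrank E U hE hU
  obtain ⟨c₀, hc₀⟩ : ∃ c₀, c₀ = -w.2.2 / 2 := ⟨_, rfl⟩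
  have hc₀_pos : 0 < c₀ := by linarith
  obtain ⟨κ, hκ⟩ : ∃ κ, κ = E - (∑ m, |a m|) ^ 2 / 2 := ⟨_, rfl⟩
  have hκ_pos : 0 < κ := by linarith
  obtain ⟨δ, hδ⟩ : ∃ δ, δ = κ * c₀ / 2 := ⟨_, rfl⟩
  have hδ_pos : 0 < δ := by rw [hδ]; positivity
  refine ⟨{w' | w'.2.2 < -c₀} ∩ {w' | w'.1 ^ 2 + ‖w'.2.1‖ ^ 2 + w'.2.2 ^ 2 = 1 ∧ w'.2.2 < 0},
    ⟨by simp only [Set.mem_ofPred_eq, hc₀]; linarith, hsph, hw⟩,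
    ⟨_, isOpen_lt (by fun_prop) continuous_const, rfl⟩, fun M => ?_⟩
  obtain ⟨T, hT⟩ := Filter.eventually_atTop.mp
    (((tendsto_exp_mul_div_sub_mul hδ_pos (r * (1 + ‖U‖))).eventually_gt_atTop M).and
      (((Filter.tendsto_id.atTop_mul_const (mul_pos hr hδ_pos)).eventually_gt_atTop M).and
        (Filter.eventually_ge_atTop 1)))
  refine ⟨T, fun t ht w' hw' => ?_⟩
  obtain ⟨hexp, hlin, ht1⟩ := hT t ht.le
  obtain ⟨x₀, v, y⟩ := w'
  obtain ⟨hy, hsphere, -⟩ := hw'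
  simp only [Set.mem_ofPred_eq, id] at hy hsphere hlin
  obtain ⟨c, rfl⟩ : ∃ c, y = -c := ⟨-y, by ring⟩
  have hc : c₀ < c := by linarith
  have hc_pos : 0 < c := hc₀_pos.trans hc
  have ht_pos : 0 < t := by linarith
  rw [Jfun_smul l r E U v x₀ c ht_pos hc_pos]
  by_cases hlarge : ∃ m, δ ≤ x₀ + ⟪v, l m⟫ ^ 2 / (2 * c)
  · obtain ⟨m, hm⟩ := hlarge
    have hx₀ : x₀ ≤ 1 := by nlinarith [sq_nonneg ‖v‖]
    have hv : ‖v‖ ≤ 1 := by nlinarith [sq_nonneg x₀, norm_nonneg v]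
    have hc1 : c ≤ 1 := by nlinarith [sq_nonneg x₀, sq_nonneg ‖v‖]
    have hUv : ⟪U, v⟫ ≤ ‖U‖ :=
      (real_inner_le_norm U v).trans (mul_le_of_le_one_right (norm_nonneg U) hv)
    have hL : t * (r * (x₀ + ⟪U, v⟫ - E * c)) ≤ t * (r * (1 + ‖U‖)) := by
      gcongr
      linarith [mul_pos hE hc_pos]
    have hsqrt : 1 / t ≤ √(2 * Real.pi / (t * c)) := by
      apply Real.le_sqrt_of_sq_le
      rw [div_pow, div_le_div_iff₀ (by positivity) (by positivity)]
      have h1 : t * c ≤ t ^ 2 := by nlinarith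
      nlinarith [Real.pi_gt_three, sq_nonneg t]
    have hsingle : Real.exp (δ * t) / t ≤
        ∑ m, √(2 * Real.pi / (t * c)) * Real.exp (t * (x₀ + ⟪v, l m⟫ ^ 2 / (2 * c))) :=
      calc Real.exp (δ * t) / t = 1 / t * Real.exp (t * δ) := by ring_nf
        _ ≤ √(2 * Real.pi / (t * c)) * Real.exp (t * (x₀ + ⟪v, l m⟫ ^ 2 / (2 * c))) := by gcongr
        _ ≤ _ := Finset.single_le_sum
          (f := fun m => √(2 * Real.pi / (t * c)) *
            Real.exp (t * (x₀ + ⟪v, l m⟫ ^ 2 / (2 * c))))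
          (fun _ _ => by positivity) (Finset.mem_univ m)
    linarith
  · push Not at hlarge
    have hL : x₀ + ⟪U, v⟫ - E * c ≤ -δ := by
      have h1 := add_inner_sub_le (by omega) ha v E hc_pos hlarge
      rw [← hκ] at h1
      have h2 : κ * c₀ ≤ κ * c := by gcongr
      linarith
    have hL' : t * (r * (x₀ + ⟪U, v⟫ - E * c)) ≤ t * (r * -δ) := by gcongr
    have hsum : 0 ≤ ∑ m, √(2 * Real.pi / (t * c)) *
        Real.exp (t * (x₀ + ⟪v, l m⟫ ^ 2 / (2 * c))) :=
      Finset.sum_nonneg fun _ _ => by positivity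
    linarith
end

section
/- Let I be a nonempty finite index set, Δξ > 0, and for each i ∈ I let m_i ∈ ℝ^{D+2} be given vectors whose linear span is all of ℝ^{D+2}. Suppose ρ ∈ ℝ^{D+2} is strictly realizable, i.e. there exist positive reals (g_i)_{i∈I} with Σ_{i∈I} g_i m_i Δξ = ρ. Then the problem of minimizing the discrete entropy H[(g_i)] = Σ_{i∈I} (g_i ln g_i − g_i) Δξ over all nonnegative families (g_i)_{i∈I} with Σ_{i∈I} g_i m_i Δξ = ρ has a unique solution (𝓔_i)_{i∈I}, which has the exponential form 𝓔_i = exp(α' · m_i) for some α' ∈ ℝ^{D+2}; moreover this α' minimizes the function J(α) = Σ_{i∈I} exp(α · m_i) Δξ − ρ · α over ℝ^{D+2}. -/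
open scoped RealInnerProductSpace

/-- Discrete entropy `H[(g_i)] = Σ_i (g_i ln g_i − g_i) Δξ`. -/
noncomputable def Hdisc {I : Type*} [Fintype I] (Δξ : ℝ) (g : I → ℝ) : ℝ :=
  ∑ i, (g i * Real.log (g i) - g i) * Δξ

/-- Strict Fenchel–Young inequality for the entropy function `x log x - x`. -/
theorem mul_sub_exp_lt_mul_log_sub {x a : ℝ} (hx : 0 ≤ x) (hxa : x ≠ Real.exp a) :
    x * a - Real.exp a < x * Real.log x - x := by
  rcases hx.eq_or_lt with rfl | hx
  · simpa using Real.exp_pos a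
  · have hne : a - Real.log x ≠ 0 := by
      intro h
      exact hxa (by rw [sub_eq_zero.mp h, Real.exp_log hx])
    have h := mul_lt_mul_of_pos_left (Real.add_one_lt_exp hne) hx
    rw [Real.exp_sub, Real.exp_log hx, mul_div_cancel₀ _ hx.ne'] at h
    linarith

/-- Fenchel–Young inequality for the entropy function `x log x - x`. -/
theorem mul_sub_exp_le_mul_log_sub {x : ℝ} (a : ℝ) (hx : 0 ≤ x) :
    x * a - Real.exp a ≤ x * Real.log x - x := by
  by_cases hxa : x = Real.exp a
  · simp [hxa]
  · exact (mul_sub_exp_lt_mul_log_sub hx hxa).le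

theorem exists_mul_abs_sub_le_exp_sub_mul {g : ℝ} (hg : 0 < g) :
    ∃ C : ℝ, ∀ a : ℝ, g * |a| - C ≤ Real.exp a - g * a := by
  refine ⟨|2 * g * Real.log (2 * g) - 2 * g|, fun a => ?_⟩
  have h := mul_sub_exp_le_mul_log_sub a (by positivity : 0 ≤ 2 * g)
  have h₁ := le_abs_self (2 * g * Real.log (2 * g) - 2 * g)
  have h₂ := abs_nonneg (2 * g * Real.log (2 * g) - 2 * g)
  rcases abs_cases a with ⟨ha, _⟩ | ⟨ha, _⟩ <;> rw [ha]
  · linarith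
  · linarith [Real.exp_pos a]

theorem tendsto_sum_exp_sub_mul_cocompact {I : Type*} [Fintype I] [Nonempty I] {g : I → ℝ}
    (hg : ∀ i, 0 < g i) :
    Filter.Tendsto (fun a : I → ℝ => ∑ i, (Real.exp (a i) - g i * a i))
      (Filter.cocompact (I → ℝ)) Filter.atTop := by
  choose C hC using fun i => exists_mul_abs_sub_le_exp_sub_mul (hg i)
  obtain ⟨j, hj⟩ := Finite.exists_min g
  have hbound (a : I → ℝ) : g j * ‖a‖ - ∑ i, C i ≤ ∑ i, (Real.exp (a i) - g i * a i) := by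
    have hnorm : ‖a‖ ≤ ∑ i, |a i| :=
      (pi_norm_le_iff_of_nonneg (Finset.sum_nonneg fun i _ => abs_nonneg _)).2 fun i =>
        Finset.single_le_sum (f := fun i => |a i|) (fun i _ => abs_nonneg _) (Finset.mem_univ i)
    calc g j * ‖a‖ - ∑ i, C i ≤ g j * ∑ i, |a i| - ∑ i, C i := by
          gcongr
          exact (hg j).le
      _ = ∑ i, (g j * |a i| - C i) := by rw [Finset.mul_sum, Finset.sum_sub_distrib]
      _ ≤ ∑ i, (Real.exp (a i) - g i * a i) := by
          refine Finset.sum_le_sum fun i _ => le_trans ?_ (hC i (a i))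
          gcongr
          exact hj i
  refine Filter.tendsto_atTop_mono hbound (Filter.tendsto_atTop_add_const_right _ _ ?_)
  exact (tendsto_norm_cocompact_atTop (E := I → ℝ)).const_mul_atTop (hg j)

section Dual

variable {E I : Type*} [NormedAddCommGroup E] [InnerProductSpace ℝ E] [Fintype I]

theorem inner_sum_smul_eq (α : E) (g : I → ℝ) (c : ℝ) (m : I → E) :
    ⟪∑ i, (g i * c) • m i, α⟫ = ∑ i, g i * ⟪α, m i⟫ * c := by
  rw [sum_inner]
  refine Finset.sum_congr rfl fun i _ => ?_
  rw [real_inner_smul_left, real_inner_comm]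
  ring

/-- The potential `α ↦ ∑ i, (exp ⟪α, m i⟫ - g i * ⟪α, m i⟫)` attains its minimum. -/
theorem exists_forall_sum_exp_inner_sub_le [FiniteDimensional ℝ E] [Nonempty I] {m : I → E}
    (hspan : Submodule.span ℝ (Set.range m) = ⊤) {g : I → ℝ} (hg : ∀ i, 0 < g i) :
    ∃ α : E, ∀ β : E, ∑ i, (Real.exp ⟪α, m i⟫ - g i * ⟪α, m i⟫) ≤
      ∑ i, (Real.exp ⟪β, m i⟫ - g i * ⟪β, m i⟫) := by
  let L : E →ₗ[ℝ] (I → ℝ) := LinearMap.pi fun i => (innerₗ E).flip (m i)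
  have hL (α : E) (i : I) : L α i = ⟪α, m i⟫ := rfl
  have hker : LinearMap.ker L = ⊥ := by
    refine (LinearMap.ker_eq_bot').2 fun α hα => ?_
    have hle : Submodule.span ℝ (Set.range m) ≤ LinearMap.ker (innerₗ E α) := by
      rw [Submodule.span_le]
      rintro _ ⟨i, rfl⟩
      exact congrFun hα i
    have hmem : α ∈ LinearMap.ker (innerₗ E α) := hle (hspan ▸ Submodule.mem_top)
    exact (inner_self_eq_zero (𝕜 := ℝ)).1 hmem
  have hcocompact := (LinearMap.isClosedEmbedding_of_injective hker).tendsto_cocompact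
  have hcont : Continuous fun α : E => ∑ i, (Real.exp ⟪α, m i⟫ - g i * ⟪α, m i⟫) := by
    fun_prop
  exact hcont.exists_forall_le ((tendsto_sum_exp_sub_mul_cocompact hg).comp hcocompact)

/-- The Euler–Lagrange equation at a minimizer of the potential
`α ↦ ∑ i, (exp ⟪α, m i⟫ - g i * ⟪α, m i⟫)`. -/
theorem sum_exp_inner_smul_eq_of_forall_le {m : I → E} {g : I → ℝ} {α : E}
    (hα : ∀ β : E, ∑ i, (Real.exp ⟪α, m i⟫ - g i * ⟪α, m i⟫) ≤
      ∑ i, (Real.exp ⟪β, m i⟫ - g i * ⟪β, m i⟫)) :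
    ∑ i, Real.exp ⟪α, m i⟫ • m i = ∑ i, g i • m i := by
  refine ext_inner_left ℝ fun v => ?_
  have hline (i : I) : HasDerivAt (fun t : ℝ => ⟪α + t • v, m i⟫) ⟪v, m i⟫ 0 := by
    simpa [inner_add_left, real_inner_smul_left] using
      ((hasDerivAt_id (0 : ℝ)).mul_const ⟪v, m i⟫).const_add ⟪α, m i⟫
  have hderiv := HasDerivAt.fun_sum (u := Finset.univ) fun i _ =>
    (hline i).exp.sub ((hline i).const_mul (g i))
  have hmin : IsLocalMin (fun t : ℝ => ∑ i, ((fun t : ℝ => Real.exp ⟪α + t • v, m i⟫) -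
      fun t : ℝ => g i * ⟪α + t • v, m i⟫) t) 0 :=
    Filter.Eventually.of_forall fun t => by simpa using hα (α + t • v)
  have hzero := hmin.hasDerivAt_eq_zero hderiv
  rw [Finset.sum_sub_distrib, sub_eq_zero] at hzero
  simpa [inner_sum, real_inner_smul_right] using hzero

end Dual

/-- for vectors `m_i` spanning `ℝ^{D+2}` and a strictly
realizable `ρ`, the minimization of the discrete entropy
`H[(g_i)] = Σ_i (g_i ln g_i − g_i) Δξ` over nonnegative families with
`Σ_i g_i m_i Δξ = ρ` has a unique solution of the exponential form
`𝓔_i = exp(α' ⬝ m_i)`; moreover `α'` minimizes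
`J(α) = Σ_i exp(α ⬝ m_i) Δξ − ρ ⬝ α` over `ℝ^{D+2}`. -/
theorem stmt_12
    (D : ℕ) (hD : 2 ≤ D)
    (I : Type*) [Fintype I] [Nonempty I]
    (Δξ : ℝ) (hΔ : 0 < Δξ)
    (mv : I → EuclideanSpace ℝ (Fin (D + 2)))
    (hspan : Submodule.span ℝ (Set.range mv) = ⊤)
    (ρ : EuclideanSpace ℝ (Fin (D + 2)))
    (hreal : ∃ g : I → ℝ, (∀ i, 0 < g i) ∧ (∑ i, (g i * Δξ) • mv i) = ρ) :
    ∃ α' : EuclideanSpace ℝ (Fin (D + 2)),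
      (∑ i, (Real.exp ⟪α', mv i⟫ * Δξ) • mv i) = ρ ∧
      (∀ g : I → ℝ, (∀ i, 0 ≤ g i) → (∑ i, (g i * Δξ) • mv i) = ρ →
        Hdisc Δξ (fun i => Real.exp ⟪α', mv i⟫) ≤ Hdisc Δξ g) ∧
      (∀ g : I → ℝ, (∀ i, 0 ≤ g i) → (∑ i, (g i * Δξ) • mv i) = ρ →
        Hdisc Δξ g = Hdisc Δξ (fun i => Real.exp ⟪α', mv i⟫) →
        g = fun i => Real.exp ⟪α', mv i⟫) ∧
      (∀ β : EuclideanSpace ℝ (Fin (D + 2)),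
        (∑ i, Real.exp ⟪α', mv i⟫ * Δξ) - ⟪ρ, α'⟫
          ≤ (∑ i, Real.exp ⟪β, mv i⟫ * Δξ) - ⟪ρ, β⟫) := by
  obtain ⟨g₀, hg₀, rfl⟩ := hreal
  obtain ⟨α, hα⟩ := exists_forall_sum_exp_inner_sub_le hspan hg₀
  have hmoment : ∑ i, (Real.exp ⟪α, mv i⟫ * Δξ) • mv i = ∑ i, (g₀ i * Δξ) • mv i := by
    simpa only [Finset.smul_sum, smul_smul, mul_comm Δξ] using
      congrArg (Δξ • ·) (sum_exp_inner_smul_eq_of_forall_le hα)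
  have hpair (g : I → ℝ) (hg : ∑ i, (g i * Δξ) • mv i = ∑ i, (g₀ i * Δξ) • mv i) :
      ∑ i, (g i * ⟪α, mv i⟫ - Real.exp ⟪α, mv i⟫) * Δξ =
        Hdisc Δξ fun i => Real.exp ⟪α, mv i⟫ := by
    have h := congrArg (⟪·, α⟫) (hg.trans hmoment.symm)
    simp only [inner_sum_smul_eq] at h
    simp only [Hdisc, Real.log_exp, sub_mul, Finset.sum_sub_distrib, h]
  have hterm (g : I → ℝ) (hg : ∀ i, 0 ≤ g i) (i : I) :
      (g i * ⟪α, mv i⟫ - Real.exp ⟪α, mv i⟫) * Δξ ≤ (g i * Real.log (g i) - g i) * Δξ :=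
    mul_le_mul_of_nonneg_right (mul_sub_exp_le_mul_log_sub _ (hg i)) hΔ.le
  refine ⟨α, hmoment, fun g hg hgρ => ?_, fun g hg hgρ hH => ?_, fun β => ?_⟩
  · rw [← hpair g hgρ]
    exact Finset.sum_le_sum fun i _ => hterm g hg i
  · rw [← hpair g hgρ] at hH
    funext i
    by_contra hne
    have hlt := mul_lt_mul_of_pos_right (mul_sub_exp_lt_mul_log_sub (hg i) hne) hΔ
    exact (Finset.sum_lt_sum (fun j _ => hterm g hg j) ⟨i, Finset.mem_univ i, hlt⟩).ne' hH
  · simpa only [inner_sum_smul_eq, ← Finset.sum_sub_distrib, ← sub_mul, ← Finset.sum_mul] using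
      mul_le_mul_of_nonneg_right (hα β) hΔ.le
end

section
/- Let N ≥ 2 and let 0 ≤ γ_1 < γ_2 < ⋯ < γ_N < π. For every N-tuple of reals (a_m)_{m=1}^N such that Σ_{m=1}^N a_m e^{iγ_m} = 1 (as complex numbers), one has Σ_{m=1}^N |a_m| ≥ (sin γ_1 + sin γ_N) / sin(γ_N − γ_1). -/
open Real

/-- if `0 ≤ γ_1 < ⋯ < γ_N < π` (with `N ≥ 2` realized as
`N = n + 2`) and `Σ_m a_m e^{iγ_m} = 1`, then
`Σ_m |a_m| ≥ (sin γ_1 + sin γ_N) / sin (γ_N − γ_1)`. -/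
theorem stmt_13
    (n : ℕ) (γ : Fin (n + 2) → ℝ) (hmono : StrictMono γ)
    (h0 : 0 ≤ γ 0) (hπ : γ (Fin.last (n + 1)) < π)
    (a : Fin (n + 2) → ℝ)
    (ha : (∑ m, (a m : ℂ) * Complex.exp ((γ m : ℂ) * Complex.I)) = 1) :
    (Real.sin (γ 0) + Real.sin (γ (Fin.last (n + 1))))
        / Real.sin (γ (Fin.last (n + 1)) - γ 0)
      ≤ ∑ m, |a m| := by
  set mid := (γ (Fin.last (n + 1)) + γ 0) / 2 with hmid
  set half := (γ (Fin.last (n + 1)) - γ 0) / 2 with hhalf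
  have hlt : γ 0 < γ (Fin.last (n + 1)) := hmono (Fin.last_pos)
  have hhalf_pos : 0 < half := by linarith
  have hhalf_lt : half < π / 2 := by linarith
  have hsin : 0 < sin half := sin_pos_of_pos_of_lt_pi hhalf_pos (by linarith)
  have hcos : 0 < cos half := cos_pos_of_mem_Ioo ⟨by linarith, hhalf_lt⟩
  have hre : ∑ m, a m * cos (γ m) = 1 := by
    simpa [Complex.exp_ofReal_mul_I_re] using congrArg Complex.re ha
  have him : ∑ m, a m * sin (γ m) = 0 := by
    simpa [Complex.exp_ofReal_mul_I_im] using congrArg Complex.im ha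
  have hsum : ∑ m, a m * sin (mid - γ m) = sin mid := by
    calc ∑ m, a m * sin (mid - γ m)
        = sin mid * ∑ m, a m * cos (γ m) - cos mid * ∑ m, a m * sin (γ m) := by
          rw [Finset.mul_sum, Finset.mul_sum, ← Finset.sum_sub_distrib]
          refine Finset.sum_congr rfl fun m _ => ?_
          rw [sin_sub]
          ring
      _ = sin mid := by rw [hre, him]; ring
  have hbound (m : Fin (n + 2)) : |sin (mid - γ m)| ≤ sin half := by
    have hl : γ 0 ≤ γ m := hmono.monotone (Fin.zero_le m)
    have hr : γ m ≤ γ (Fin.last (n + 1)) := hmono.monotone (Fin.le_last m)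
    rw [abs_le, ← sin_neg]
    constructor <;> apply sin_le_sin_of_le_of_le_pi_div_two <;> linarith
  have hmain : sin mid ≤ (∑ m, |a m|) * sin half := by
    rw [← hsum, Finset.sum_mul]
    refine Finset.sum_le_sum fun m _ => (le_abs_self _).trans ?_
    rw [abs_mul]
    exact mul_le_mul_of_nonneg_left (hbound m) (abs_nonneg _)
  have hfirst : γ 0 = mid - half := by rw [hmid, hhalf]; ring
  have hlast : γ (Fin.last (n + 1)) = mid + half := by rw [hmid, hhalf]; ring
  have hnum : sin (γ 0) + sin (γ (Fin.last (n + 1))) = sin mid * (2 * cos half) := by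
    rw [hfirst, hlast, sin_sub, sin_add]
    ring
  have hden : sin (γ (Fin.last (n + 1)) - γ 0) = sin half * (2 * cos half) := by
    rw [show γ (Fin.last (n + 1)) - γ 0 = 2 * half by rw [hhalf]; ring, sin_two_mul]
    ring
  rw [hnum, hden, mul_div_mul_right _ _ (by positivity), div_le_iff₀ hsin]
  exact hmain
end

section
/- Define S(γ₊, γ₋) = (sin γ₊ − sin γ₋) / sin(γ₊ − γ₋) on the domain Ω = { (γ₊, γ₋) : γ₊ ∈ (0, π), γ₋ ∈ (−π, 0), γ₊ − γ₋ < π }. Then S is monotonically nondecreasing in γ₊ and nonincreasing in γ₋ on Ω: its partial derivative with respect to γ₊ equals sin γ₋ (cos(γ₊ − γ₋) − 1) / sin²(γ₊ − γ₋) ≥ 0, and its partial derivative with respect to γ₋ is ≤ 0. -/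
open Real

/-- `S(γ₊, γ₋) = (sin γ₊ − sin γ₋) / sin (γ₊ − γ₋)`. -/
noncomputable def Sfun (a b : ℝ) : ℝ := (Real.sin a - Real.sin b) / Real.sin (a - b)

theorem Sfun_neg_swap (a b : ℝ) : Sfun (-b) (-a) = Sfun a b := by
  unfold Sfun
  rw [Real.sin_neg, Real.sin_neg, show -b - -a = a - b by ring,
    show -Real.sin b - -Real.sin a = Real.sin a - Real.sin b by ring]

theorem hasDerivAt_Sfun_left {a b : ℝ} (h : Real.sin (a - b) ≠ 0) :
    HasDerivAt (fun x => Sfun x b)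
      (Real.sin b * (Real.cos (a - b) - 1) / Real.sin (a - b) ^ 2) a := by
  have hnum := (Real.hasDerivAt_sin a).sub_const (Real.sin b)
  have hden := ((hasDerivAt_id a).sub_const b).sin
  refine (hnum.div hden h).congr_deriv ?_
  have hsub : Real.sin b = Real.sin a * Real.cos (a - b) - Real.cos a * Real.sin (a - b) := by
    rw [← Real.sin_sub, sub_sub_cancel]
  congr 1
  simp only [id]
  linear_combination hsub

theorem Sfun_left_deriv_nonneg {a b : ℝ} (hb : -π < b) (hb' : b < 0) :
    0 ≤ Real.sin b * (Real.cos (a - b) - 1) / Real.sin (a - b) ^ 2 := by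
  refine div_nonneg (mul_nonneg_of_nonpos_of_nonpos ?_ ?_) (sq_nonneg _)
  · exact (Real.sin_neg_of_neg_of_neg_pi_lt hb' hb).le
  · linarith [Real.cos_le_one (a - b)]

theorem Sfun_le_Sfun_left {a a' b : ℝ} (ha : 0 < a) (hb : -π < b) (hb' : b < 0)
    (haa' : a ≤ a') (h : a' - b < π) : Sfun a b ≤ Sfun a' b := by
  have hd : ∀ x ∈ Set.Icc a a', HasDerivAt (fun x => Sfun x b)
      (Real.sin b * (Real.cos (x - b) - 1) / Real.sin (x - b) ^ 2) x := fun x hx =>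
    hasDerivAt_Sfun_left (Real.sin_pos_of_pos_of_lt_pi (by linarith [hx.1])
      (by linarith [hx.2])).ne'
  have hmono : MonotoneOn (fun x => Sfun x b) (Set.Icc a a') :=
    monotoneOn_of_hasDerivWithinAt_nonneg (convex_Icc a a')
      (fun x hx => (hd x hx).continuousAt.continuousWithinAt)
      (fun x hx => (hd x (interior_subset hx)).hasDerivWithinAt)
      (fun x _ => Sfun_left_deriv_nonneg hb hb')
  exact hmono (Set.left_mem_Icc.2 haa') (Set.right_mem_Icc.2 haa') haa'

/-- on `Ω = {(γ₊, γ₋) : γ₊ ∈ (0,π), γ₋ ∈ (−π,0), γ₊ − γ₋ < π}`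
the function `S` is nondecreasing in `γ₊` and nonincreasing in `γ₋`: its
`γ₊`-partial derivative equals `sin γ₋ (cos (γ₊ − γ₋) − 1)/sin² (γ₊ − γ₋) ≥ 0`
and its `γ₋`-partial derivative is `≤ 0`. -/
theorem stmt_16 :
    ∀ a b : ℝ, 0 < a → a < π → -π < b → b < 0 → a - b < π →
      (HasDerivAt (fun x => Sfun x b)
          (Real.sin b * (Real.cos (a - b) - 1) / Real.sin (a - b) ^ 2) a ∧
        0 ≤ Real.sin b * (Real.cos (a - b) - 1) / Real.sin (a - b) ^ 2) ∧
      (∃ d : ℝ, HasDerivAt (fun y => Sfun a y) d b ∧ d ≤ 0) ∧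
      (∀ a' : ℝ, a ≤ a' → a' < π → a' - b < π → Sfun a b ≤ Sfun a' b) ∧
      (∀ b' : ℝ, b ≤ b' → b' < 0 → Sfun a b' ≤ Sfun a b) := by
  intro a b ha ha' hb hb' hab
  have hsin : Real.sin (a - b) ≠ 0 :=
    (Real.sin_pos_of_pos_of_lt_pi (by linarith) hab).ne'
  refine ⟨⟨hasDerivAt_Sfun_left hsin, Sfun_left_deriv_nonneg hb hb'⟩, ?_, ?_, ?_⟩
  · have hswap : -b - -a = a - b := by ring
    have h := (hasDerivAt_Sfun_left (a := -b) (b := -a) (by rwa [hswap])).comp b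
      (hasDerivAt_neg b)
    have hfun : (fun x => Sfun x (-a)) ∘ Neg.neg = fun y => Sfun a y :=
      funext fun y => Sfun_neg_swap a y
    refine ⟨_, hfun ▸ h, ?_⟩
    have hnonneg := Sfun_left_deriv_nonneg (a := -b) (b := -a) (by linarith) (by linarith)
    linarith
  · intro a' haa' _ h
    exact Sfun_le_Sfun_left ha hb hb' haa' h
  · intro b' hbb' hb'0
    rw [← Sfun_neg_swap a b', ← Sfun_neg_swap a b]
    exact Sfun_le_Sfun_left (by linarith) (by linarith) (by linarith) (by linarith)
      (by linarith)
end

section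
/- Let τ > 0, let l ∈ ℝ^{D_x} be a fixed vector, and let E : [0,∞) × ℝ^{D_x} × ℝ → ℝ be continuous with E > 0 everywhere. Suppose f : [0,∞) × ℝ^{D_x} × ℝ → ℝ is continuously differentiable in (t, x), satisfies ∂_t f(t,x,ξ) + ξ l · ∇_x f(t,x,ξ) = (1/τ)(E(t,x,ξ) − f(t,x,ξ)) for all t ≥ 0, x ∈ ℝ^{D_x}, ξ ∈ ℝ, and has positive initial data f(0,x,ξ) > 0 for all x, ξ. Then f(t,x,ξ) > 0 for all t ≥ 0, x ∈ ℝ^{D_x}, ξ ∈ ℝ. -/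
open MeasureTheory

/-- A solution of the linear relaxation equation `h' = (1/τ)(e − h)` with nonnegative source `e`
and positive initial value stays positive. -/
theorem pos_of_hasDerivAt_relaxation {τ : ℝ} (hτ : 0 < τ) {h e : ℝ → ℝ}
    (hh : ∀ s, 0 ≤ s → HasDerivAt h (1 / τ * (e s - h s)) s)
    (he : ∀ s, 0 ≤ s → 0 ≤ e s) (h0 : 0 < h 0) {t : ℝ} (ht : 0 ≤ t) : 0 < h t := by
  have hg : ∀ s, 0 ≤ s →
      HasDerivAt (fun s => Real.exp (s / τ) * h s) (Real.exp (s / τ) * (1 / τ * e s)) s := by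
    intro s hs
    refine ((((hasDerivAt_id' s).div_const τ).exp).mul (hh s hs)).congr_deriv ?_
    ring
  have hmono : MonotoneOn (fun s => Real.exp (s / τ) * h s) (Set.Ici 0) := by
    refine monotoneOn_of_hasDerivWithinAt_nonneg (convex_Ici 0)
      (fun s hs => (hg s hs).continuousAt.continuousWithinAt)
      (fun s hs => (hg s (interior_subset hs)).hasDerivWithinAt) fun s hs => ?_
    have := he s (interior_subset hs)
    positivity
  have hle := hmono Set.self_mem_Ici ht ht
  simp only [zero_div, Real.exp_zero, one_mul] at hle
  exact pos_of_mul_pos_right (h0.trans_le hle) (Real.exp_pos _).le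

/-- positivity: if `f` is continuously differentiable in
`(t, x)` (with derivative `DF`), satisfies
`∂_t f + ξ l ⬝ ∇ₓ f = (1/τ)(E − f)` for `t ≥ 0` with `E` continuous and
positive on `t ≥ 0`, and has positive initial data `f(0,x,ξ) > 0`, then
`f(t,x,ξ) > 0` for all `t ≥ 0`, `x`, `ξ`.  The transport term
`∂_t f + ξ l ⬝ ∇ₓ f` is expressed as the directional derivative
`DF t x ξ (1, ξ • l)` of `(t, x) ↦ f t x ξ`. -/
theorem stmt_19
    (Dx : ℕ) (hDx : 1 ≤ Dx) (τ : ℝ) (hτ : 0 < τ)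
    (l : EuclideanSpace ℝ (Fin Dx))
    (Efun f : ℝ → EuclideanSpace ℝ (Fin Dx) → ℝ → ℝ)
    (hEcont : ContinuousOn
      (fun p : ℝ × EuclideanSpace ℝ (Fin Dx) × ℝ => Efun p.1 p.2.1 p.2.2)
      {p : ℝ × EuclideanSpace ℝ (Fin Dx) × ℝ | 0 ≤ p.1})
    (hEpos : ∀ (t : ℝ) (x : EuclideanSpace ℝ (Fin Dx)) (ξ : ℝ),
      0 ≤ t → 0 < Efun t x ξ)
    (DF : ℝ → EuclideanSpace ℝ (Fin Dx) → ℝ →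
      (ℝ × EuclideanSpace ℝ (Fin Dx)) →L[ℝ] ℝ)
    (hDFcont : ∀ ξ : ℝ, ContinuousOn
      (fun p : ℝ × EuclideanSpace ℝ (Fin Dx) => DF p.1 p.2 ξ)
      {p : ℝ × EuclideanSpace ℝ (Fin Dx) | 0 ≤ p.1})
    (hderiv : ∀ t : ℝ, 0 ≤ t → ∀ (x : EuclideanSpace ℝ (Fin Dx)) (ξ : ℝ),
      HasFDerivAt (fun p : ℝ × EuclideanSpace ℝ (Fin Dx) => f p.1 p.2 ξ)
        (DF t x ξ) (t, x))
    (hpde : ∀ t : ℝ, 0 ≤ t → ∀ (x : EuclideanSpace ℝ (Fin Dx)) (ξ : ℝ),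
      DF t x ξ (1, ξ • l) = 1 / τ * (Efun t x ξ - f t x ξ))
    (hinit : ∀ (x : EuclideanSpace ℝ (Fin Dx)) (ξ : ℝ), 0 < f 0 x ξ) :
    ∀ t : ℝ, 0 ≤ t → ∀ (x : EuclideanSpace ℝ (Fin Dx)) (ξ : ℝ),
      0 < f t x ξ := by
  intro t ht x ξ
  have hpath : ∀ s : ℝ, HasDerivAt (fun s : ℝ => (s, x + (s - t) • ξ • l)) (1, ξ • l) s := by
    intro s
    have h := (((hasDerivAt_id s).sub_const t).smul_const (ξ • l)).const_add x
    rw [one_smul] at h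
    exact (hasDerivAt_id s).prodMk h
  have hpos := pos_of_hasDerivAt_relaxation hτ
    (h := fun s => f s (x + (s - t) • ξ • l) ξ) (e := fun s => Efun s (x + (s - t) • ξ • l) ξ)
    (fun s hs => by
      rw [← hpde s hs]
      exact (hderiv s hs (x + (s - t) • ξ • l) ξ).comp_hasDerivAt s (hpath s))
    (fun s hs => (hEpos s _ ξ hs).le) (hinit _ ξ) ht
  simpa using hpos
end
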